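/- If T consists of two (not necessarily binary) rooted phylogenetic trees on the same finite taxa set X, then r_tr(T) = h⁰(T) = r(Cl(T)). -/

import Mathlib

open scoped Classical

namespace Phylo

variable {α : Type} [DecidableEq α]

/-- A finite directed graph whose vertices carry labels from `α`; used to model
rooted phylogenetic networks and trees. -/
structure Net (α : Type) where
  n : ℕ
  E : Finset (Fin n × Fin n)
  label : Fin n → α

namespace Net

def indeg (N : Net α) (v : Fin N.n) : ℕ := (N.E.filter fun e => e.2 = v).card

def outdeg (N : Net α) (v : Fin N.n) : ℕ := (N.E.filter fun e => e.1 = v).card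

def Adj (N : Net α) (u v : Fin N.n) : Prop := (u, v) ∈ N.E

def Reaches (N : Net α) : Fin N.n → Fin N.n → Prop := Relation.ReflTransGen N.Adj

def IsLeaf (N : Net α) (v : Fin N.n) : Prop := N.outdeg v = 0

/-- The set of labels of leaves reachable from `v` by directed paths. -/
noncomputable def clusterBelow (N : Net α) (v : Fin N.n) : Finset α :=
  (Finset.univ.filter fun w => N.Reaches v w ∧ N.IsLeaf w).image N.label

/-- The reticulation number `r(N) = Σ_{v : indeg(v) > 0} (indeg(v) - 1)`. -/
def reticNum (N : Net α) : ℕ := ∑ v, (N.indeg v - 1)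

end Net

/-- `N` is a rooted phylogenetic network on the taxa set `X`: an acyclic digraph with a
unique root (indegree-0 node), no node with indegree 1 and outdegree 1, every
reticulation (indegree ≥ 2) having outdegree ≥ 1, and leaves bijectively labeled by `X`. -/
def IsPhyloNet (X : Finset α) (N : Net α) : Prop :=
  (∀ v : Fin N.n, ¬ Relation.TransGen N.Adj v v) ∧
  (∃! ρ : Fin N.n, N.indeg ρ = 0) ∧
  (∀ v : Fin N.n, ¬ (N.indeg v = 1 ∧ N.outdeg v = 1)) ∧
  (∀ v : Fin N.n, 2 ≤ N.indeg v → 1 ≤ N.outdeg v) ∧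
  Set.BijOn N.label {v | N.IsLeaf v} (X : Set α)

/-- A rooted phylogenetic tree on `X` is a network on `X` with reticulation number 0. -/
def IsPhyloTree (X : Finset α) (N : Net α) : Prop := IsPhyloNet X N ∧ N.reticNum = 0

/-- A network is binary if every reticulation has indegree 2 and outdegree 1 and every
non-leaf tree node has outdegree 2. -/
def IsBinary (N : Net α) : Prop :=
  ∀ v : Fin N.n, (N.indeg v ≤ 1 → N.outdeg v = 0 ∨ N.outdeg v = 2) ∧
    (2 ≤ N.indeg v → N.indeg v = 2 ∧ N.outdeg v = 1)

/-- The internal vertices of a path given as a list of vertices. -/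
def internals {β : Type*} (p : List β) : List β := p.tail.dropLast

def IsDirPath (N : Net α) (u v : Fin N.n) (p : List (Fin N.n)) : Prop :=
  p.head? = some u ∧ p.getLast? = some v ∧ p.Chain' N.Adj ∧ 2 ≤ p.length

/-- `N` displays `T`: `T` can be obtained from `N` by deleting nodes and edges and
suppressing indegree-1 outdegree-1 nodes, formalized as a topological embedding:
each edge of `T` maps to a directed path of `N`, paths being internally disjoint
from each other and from the images of the nodes of `T`, and leaves of `T` map to
leaves of `N` with the same label. -/
def Displays (N T : Net α) : Prop :=
  ∃ φ : Fin T.n → Fin N.n, Function.Injective φ ∧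
    (∀ v, T.IsLeaf v → N.IsLeaf (φ v) ∧ N.label (φ v) = T.label v) ∧
    ∃ P : Fin T.n × Fin T.n → List (Fin N.n),
      (∀ e ∈ T.E, IsDirPath N (φ e.1) (φ e.2) (P e)) ∧
      (∀ e ∈ T.E, ∀ w ∈ internals (P e), w ∉ Set.range φ) ∧
      (∀ e ∈ T.E, ∀ f ∈ T.E, e ≠ f → ∀ w ∈ internals (P e), w ∉ internals (P f))

/-- `N` represents the cluster `C` in the softwired sense: some tree on `X` displayed by
`N` has an edge whose set of leaf descendants is exactly `C`. -/
def RepresentsCluster (X : Finset α) (N : Net α) (C : Finset α) : Prop :=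
  ∃ T : Net α, IsPhyloTree X T ∧ Displays N T ∧ ∃ e ∈ T.E, T.clusterBelow e.2 = C

def RepresentsSet (X : Finset α) (N : Net α) (𝒞 : Set (Finset α)) : Prop :=
  ∀ C ∈ 𝒞, RepresentsCluster X N C

/-- `Cl(T)`: the set of clusters represented by edges of the tree `T`. -/
def clSet (T : Net α) : Set (Finset α) := {C | ∃ e ∈ T.E, T.clusterBelow e.2 = C}

/-- `r(𝒞)`: the minimum reticulation number of a network on `X` representing `𝒞`. -/
noncomputable def rNum (X : Finset α) (𝒞 : Set (Finset α)) : ℕ :=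
  sInf {k | ∃ N : Net α, IsPhyloNet X N ∧ RepresentsSet X N 𝒞 ∧ N.reticNum = k}

/-- A cluster on `X` is a nonempty proper subset of `X`. -/
def IsCluster (X C : Finset α) : Prop := C ⊆ X ∧ C.Nonempty ∧ C ≠ X

def IsClusterSet (X : Finset α) (𝒞 : Set (Finset α)) : Prop := ∀ C ∈ 𝒞, IsCluster X C

def Compatible (A B : Finset α) : Prop := A ∩ B = ∅ ∨ A ⊆ B ∨ B ⊆ A

/-- `𝒞 \ S`: remove the elements of `S` from each cluster, discarding emptied clusters. -/
def removeTaxa (𝒞 : Set (Finset α)) (S : Finset α) : Set (Finset α) :=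
  {D | D.Nonempty ∧ ∃ C ∈ 𝒞, D = C \ S}

/-- `𝒞 | S`: the restriction of `𝒞` to `S`. -/
def restrictTo (𝒞 : Set (Finset α)) (S : Finset α) : Set (Finset α) :=
  {D | D.Nonempty ∧ ∃ C ∈ 𝒞, D = C ∩ S}

/-- `S` is unseparated by `𝒞`: no cluster of `𝒞` is incompatible with `S`. -/
def Unseparated (𝒞 : Set (Finset α)) (S : Finset α) : Prop := ∀ C ∈ 𝒞, Compatible C S

/-- `𝒞` separates every proper subset of `X` with at least two elements. -/
def Separating (X : Finset α) (𝒞 : Set (Finset α)) : Prop :=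
  ∀ X' : Finset α, X' ⊂ X → 2 ≤ X'.card → ∃ C ∈ 𝒞, ¬ Compatible C X'

def PairwiseCompatible (𝒞 : Set (Finset α)) : Prop := ∀ A ∈ 𝒞, ∀ B ∈ 𝒞, Compatible A B

/-- `S` is an ST-set with respect to `𝒞`. -/
def IsSTSet (X : Finset α) (𝒞 : Set (Finset α)) (S : Finset α) : Prop :=
  S ⊆ X ∧ Unseparated 𝒞 S ∧ PairwiseCompatible (restrictTo 𝒞 S)

/-- `S` is a maximal ST-set: no ST-set properly contains it. -/
def IsMaxSTSet (X : Finset α) (𝒞 : Set (Finset α)) (S : Finset α) : Prop :=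
  IsSTSet X 𝒞 S ∧ ∀ S', IsSTSet X 𝒞 S' → ¬ S ⊂ S'

/-- `(S₁, …, S_p)` is a maximal ST-set sequence of `𝒞`. -/
def IsMaxSTSeq : Finset α → Set (Finset α) → List (Finset α) → Prop
  | _, _, [] => True
  | X, 𝒞, S :: L => IsMaxSTSet X 𝒞 S ∧ IsMaxSTSeq (X \ S) (removeTaxa 𝒞 S) L

/-- `(S₁, …, S_p)` is an ST-set sequence of `𝒞` (empty ST-sets allowed). -/
def IsSTSeq : Finset α → Set (Finset α) → List (Finset α) → Prop
  | _, _, [] => True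
  | X, 𝒞, S :: L => IsSTSet X 𝒞 S ∧ IsSTSeq (X \ S) (removeTaxa 𝒞 S) L

def removeAll (𝒞 : Set (Finset α)) (L : List (Finset α)) : Set (Finset α) :=
  L.foldl removeTaxa 𝒞

/-- A maximal ST-set *tree* sequence: additionally the remaining clusters are pairwise
compatible. -/
def IsMaxSTTreeSeq (X : Finset α) (𝒞 : Set (Finset α)) (L : List (Finset α)) : Prop :=
  IsMaxSTSeq X 𝒞 L ∧ PairwiseCompatible (removeAll 𝒞 L)

def IsSTTreeSeq (X : Finset α) (𝒞 : Set (Finset α)) (L : List (Finset α)) : Prop :=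
  IsSTSeq X 𝒞 L ∧ PairwiseCompatible (removeAll 𝒞 L)

/-- The MST lower bound: minimum length of a maximal ST-set tree sequence of `𝒞`. -/
noncomputable def mstLB (X : Finset α) (𝒞 : Set (Finset α)) : ℕ :=
  sInf {p | ∃ L, IsMaxSTTreeSeq X 𝒞 L ∧ L.length = p}

/- Underlying undirected notions, biconnected components and the level of a network. -/

def uadj (N : Net α) (F : Finset (Fin N.n × Fin N.n)) (u v : Fin N.n) : Prop :=
  (u, v) ∈ F ∨ (v, u) ∈ F

def verts (N : Net α) (F : Finset (Fin N.n × Fin N.n)) : Finset (Fin N.n) :=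
  F.image Prod.fst ∪ F.image Prod.snd

def ConnOn (N : Net α) (F : Finset (Fin N.n × Fin N.n)) : Prop :=
  ∀ u ∈ verts N F, ∀ v ∈ verts N F, Relation.ReflTransGen (uadj N F) u v

def delVert (N : Net α) (F : Finset (Fin N.n × Fin N.n)) (v : Fin N.n) :
    Finset (Fin N.n × Fin N.n) :=
  F.filter fun e => e.1 ≠ v ∧ e.2 ≠ v

def HasCutNodeOn (N : Net α) (F : Finset (Fin N.n × Fin N.n)) : Prop :=
  ∃ v ∈ verts N F, ∃ a ∈ verts N F, ∃ b ∈ verts N F, a ≠ v ∧ b ≠ v ∧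
    ¬ Relation.ReflTransGen (uadj N (delVert N F v)) a b

/-- The (edge set of a) subgraph is biconnected: connected and without cut-nodes. -/
def Biconn (N : Net α) (F : Finset (Fin N.n × Fin N.n)) : Prop :=
  F.Nonempty ∧ ConnOn N F ∧ ¬ HasCutNodeOn N F

/-- `F` is a biconnected component of `N`: a maximal biconnected subgraph. -/
def IsBCC (N : Net α) (F : Finset (Fin N.n × Fin N.n)) : Prop :=
  F ⊆ N.E ∧ Biconn N F ∧ ∀ F', F' ⊆ N.E → Biconn N F' → F ⊆ F' → F' = F

/-- Reticulation number of a biconnected component, indegrees computed within it. -/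
def compRetic (N : Net α) (F : Finset (Fin N.n × Fin N.n)) : ℕ :=
  ∑ v ∈ verts N F, ((F.filter fun e => e.2 = v).card - 1)

/-- The level of `N`: the maximum reticulation number of a biconnected component. -/
noncomputable def level (N : Net α) : ℕ :=
  sSup {k | ∃ F, IsBCC N F ∧ compRetic N F = k}

def IsCutEdge (N : Net α) (e : Fin N.n × Fin N.n) : Prop :=
  e ∈ N.E ∧ ∃ a b : Fin N.n, ¬ Relation.ReflTransGen (uadj N (N.E.erase e)) a b

def IsCutNode (N : Net α) (v : Fin N.n) : Prop :=
  ∃ a b : Fin N.n, a ≠ v ∧ b ≠ v ∧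
    ¬ Relation.ReflTransGen (uadj N (delVert N N.E v)) a b

/-- `N` is simple: removal of any cut-node or cut-edge leaves at most one non-trivial
connected component (all remaining edges lie in a single component). -/
def IsSimpleNet (N : Net α) : Prop :=
  (∀ v : Fin N.n, IsCutNode N v → ∀ f ∈ delVert N N.E v, ∀ g ∈ delVert N N.E v,
      Relation.ReflTransGen (uadj N (delVert N N.E v)) f.1 g.1) ∧
  (∀ e : Fin N.n × Fin N.n, IsCutEdge N e → ∀ f ∈ N.E.erase e, ∀ g ∈ N.E.erase e,
      Relation.ReflTransGen (uadj N (N.E.erase e)) f.1 g.1)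

/-- The non-trivial ST-set `S` is under a cut-edge of `N`: `N` has a cut-edge `(u,v)`
such that the subnetwork rooted at `v` is a tree whose taxa set is `S` and which
represents the cluster set `𝒞 | S`. -/
def UnderCutEdge (𝒞 : Set (Finset α)) (N : Net α) (S : Finset α) : Prop :=
  ∃ e ∈ N.E, IsCutEdge N e ∧ N.clusterBelow e.2 = S ∧
    (∀ w : Fin N.n, N.Reaches e.2 w →
      (N.E.filter fun f => f.2 = w ∧ N.Reaches e.2 f.1).card ≤ 1) ∧
    ∀ C ∈ restrictTo 𝒞 S, ∃ f ∈ N.E, N.Reaches e.2 f.1 ∧ N.clusterBelow f.2 = C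

/-- The subnetwork of `N` rooted at `v` is exactly (isomorphic to) `T`. -/
def IsoSubnetAt (N : Net α) (v : Fin N.n) (T : Net α) : Prop :=
  ∃ g : Fin T.n → Fin N.n, Function.Injective g ∧
    Set.range g = {w | N.Reaches v w} ∧
    (∀ a b : Fin T.n, (a, b) ∈ T.E ↔ (g a, g b) ∈ N.E) ∧
    ∀ a : Fin T.n, T.IsLeaf a → N.label (g a) = T.label a

/-- `T` is a subtree below a reticulation (SBR) of `N`. -/
def IsSBR (N T : Net α) : Prop :=
  ∃ v : Fin N.n, 2 ≤ N.indeg v ∧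
    (∀ w : Fin N.n, N.Reaches v w → w ≠ v → N.indeg w < 2) ∧
    ((N.outdeg v = 1 ∧ ∃ c : Fin N.n, (v, c) ∈ N.E ∧ IsoSubnetAt N c T) ∨
     (N.outdeg v ≠ 1 ∧ IsoSubnetAt N v T))

/-- `T'` is a (not necessarily binary) refinement of `T`: a tree on `X` with
`Cl(T) ⊆ Cl(T')`. -/
def IsRefinement (X : Finset α) (T T' : Net α) : Prop :=
  IsPhyloTree X T' ∧ clSet T ⊆ clSet T'

/-- `h⁰(𝒯)`: minimum reticulation number of a network on `X` displaying some
refinement of each tree of the family. -/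
noncomputable def h0 (X : Finset α) {m : ℕ} (T : Fin m → Net α) : ℕ :=
  sInf {k | ∃ N : Net α, IsPhyloNet X N ∧
    (∀ i, ∃ T', IsRefinement X (T i) T' ∧ Displays N T') ∧ N.reticNum = k}

/-- `h⁻(𝒯)`: minimum reticulation number of a network on `X` displaying some *binary*
refinement of each tree of the family. -/
noncomputable def hminus (X : Finset α) {m : ℕ} (T : Fin m → Net α) : ℕ :=
  sInf {k | ∃ N : Net α, IsPhyloNet X N ∧
    (∀ i, ∃ T', IsRefinement X (T i) T' ∧ IsBinary T' ∧ Displays N T') ∧ N.reticNum = k}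

/-- `N` is consistent with the rooted triplet `xy|z`: it displays the binary tree on
`{x,y,z}` in which `{x,y}` is a cluster. -/
def ConsistentTriplet (N : Net α) (x y z : α) : Prop :=
  ∃ t : Net α, IsPhyloTree ({x, y, z} : Finset α) t ∧ IsBinary t ∧
    (∃ e ∈ t.E, t.clusterBelow e.2 = ({x, y} : Finset α)) ∧ Displays N t

/-- `r_tr(𝒯)`: minimum reticulation number of a network on `X` consistent with every
rooted triplet consistent with some tree of the family. -/
noncomputable def rtr (X : Finset α) {m : ℕ} (T : Fin m → Net α) : ℕ :=
  sInf {k | ∃ N : Net α, IsPhyloNet X N ∧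
    (∀ x y z : α, x ≠ y → y ≠ z → x ≠ z →
      (∃ i, ConsistentTriplet (T i) x y z) → ConsistentTriplet N x y z) ∧
    N.reticNum = k}

/-- `𝒞_{U → u}`: replace all elements of `U` in every cluster by the single taxon `u`. -/
def collapseTo (𝒞 : Set (Finset α)) (U : Finset α) (u : α) : Set (Finset α) :=
  {D | ∃ C ∈ 𝒞, D = if (C ∩ U).Nonempty then (C \ U) ∪ {u} else C}

end Phylo

namespace Phylo

section LB
open Relation
variable {α : Type} {V : Type}

theorem rtg_comparable {r : V → V → Prop} (hr : ∀ a b c, r a c → r b c → a = b) {p u x : V}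
    (h1 : ReflTransGen r p x) (h2 : ReflTransGen r u x) :
    ReflTransGen r p u ∨ ReflTransGen r u p := by
  induction h1 with
  | refl => exact Or.inr h2
  | tail hb hbc ih =>
    rcases ReflTransGen.cases_tail h2 with h | ⟨d, hd, hdc⟩
    · subst h; exact Or.inl (hb.tail hbc)
    · have := hr _ _ _ hdc hbc
      subst this
      exact ih hd

/-- Cost of reducing the taxa set by cherry reductions (free) and deletions (cost one). -/
inductive Red (𝒞 : Set (Finset α)) : Finset α → ℕ → Prop
  | single (x : α) (k : ℕ) : Red 𝒞 {x} k
  | cherry (Y : Finset α) (x y : α) (k : ℕ) (hx : x ∈ Y) (hy : y ∈ Y) (hxy : x ≠ y)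
      (h1 : ∀ C ∈ 𝒞, x ∈ C → y ∉ C → ∀ z ∈ Y, z ∈ C → z = x)
      (h2 : ∀ C ∈ 𝒞, y ∈ C → x ∉ C → ∀ z ∈ Y, z ∈ C → z = y)
      (h : Red 𝒞 (Y.erase x) k) : Red 𝒞 Y k
  | del (Y : Finset α) (x : α) (k : ℕ) (hx : x ∈ Y) (hne : (Y.erase x).Nonempty)
      (h : Red 𝒞 (Y.erase x) k) : Red 𝒞 Y (k + 1)

theorem Red.succ {𝒞 : Set (Finset α)} {Y : Finset α} {k : ℕ} (h : Red 𝒞 Y k) :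
    Red 𝒞 Y (k + 1) := by
  induction h with
  | single x k => exact .single x _
  | cherry Y x y k hx hy hxy h1 h2 h ih => exact .cherry Y x y _ hx hy hxy h1 h2 ih
  | del Y x k hx hne h ih => exact .del Y x _ hx hne ih

theorem Red.mono {𝒞 : Set (Finset α)} {Y : Finset α} {k l : ℕ} (h : Red 𝒞 Y k) (hkl : k ≤ l) :
    Red 𝒞 Y l := by
  induction hkl with
  | refl => exact h
  | step _ ih => exact ih.succ

theorem Red.exists {𝒞 : Set (Finset α)} (Y : Finset α) (h : Y.Nonempty) : ∃ k, Red 𝒞 Y k := by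
  induction Y using Finset.strongInduction with
  | H Y ih =>
    obtain ⟨x, hx⟩ := h
    by_cases hne : (Y.erase x).Nonempty
    · obtain ⟨k, hk⟩ := ih _ (Finset.erase_ssubset hx) hne
      exact ⟨k + 1, .del Y x k hx hne hk⟩
    · have : Y = {x} := by
        rw [Finset.not_nonempty_iff_eq_empty, Finset.erase_eq_empty_iff] at hne
        rcases hne with h | h
        · simp [h] at hx
        · exact h
      subst this
      exact ⟨0, .single x 0⟩

def SR (E : V → V → Prop) (σ : V → V) : V → V → Prop :=
  ReflTransGen (fun a b => E a b ∧ σ b = a)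

def Spans (E : V → V → Prop) (σ : V → V) : Prop := ∀ b, (∃ a, E a b) → E (σ b) b

def Sep (E : V → V → Prop) (ℓ : α → V) (x z y : α) : Prop :=
  ∃ σ : V → V, Spans E σ ∧ ∃ p, SR E σ p (ℓ x) ∧ SR E σ p (ℓ z) ∧ ¬ SR E σ p (ℓ y)

theorem SR.reach {E : V → V → Prop} {σ : V → V} {a b : V} (h : SR E σ a b) :
    ReflTransGen E a b := ReflTransGen.mono (fun _ _ h => h.1) _ _ h

theorem exists_lowest [Finite V] {E : V → V → Prop} (hac : ∀ v, ¬ TransGen E v v)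
    (Q : V → Prop) (h : ∃ v, Q v) : ∃ v, Q v ∧ ∀ w, TransGen E v w → ¬ Q w := by
  have : IsStrictOrder V (fun a b => TransGen E b a) :=
    { irrefl := hac, trans := fun a b c h1 h2 => TransGen.trans h2 h1 }
  have wf : WellFounded (fun a b => TransGen E b a) := Finite.wellFounded_of_trans_of_irrefl _
  obtain ⟨v, hv, hm⟩ := wf.has_min {v | Q v} h
  exact ⟨v, hv, fun w hw hq => hm w hq hw⟩

theorem cherry_of_tree [Finite V] {E : V → V → Prop} (hac : ∀ v, ¬ TransGen E v v) (ℓ : α → V)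
    (Y : Finset α) (𝒞 : Set (Finset α))
    (hsep : ∀ C ∈ 𝒞, ∀ x ∈ Y, ∀ z ∈ Y, ∀ y ∈ Y, x ≠ z → x ∈ C → z ∈ C → y ∉ C → Sep E ℓ x z y)
    (v : V) (hv : ∀ w, TransGen E v w → ∀ a b, E a w → E b w → a = b)
    (h2 : ∃ x ∈ Y, ∃ y ∈ Y, x ≠ y ∧ ReflTransGen E v (ℓ x) ∧ ReflTransGen E v (ℓ y)) :
    ∃ x ∈ Y, ∃ y ∈ Y, x ≠ y ∧
      (∀ C ∈ 𝒞, x ∈ C → y ∉ C → ∀ z ∈ Y, z ∈ C → z = x) ∧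
      (∀ C ∈ 𝒞, y ∈ C → x ∉ C → ∀ z ∈ Y, z ∈ C → z = y) := by
  obtain ⟨u, ⟨hvu, x, hx, y, hy, hxy, hux, huy⟩, hlow⟩ := exists_lowest hac
    (fun u => ReflTransGen E v u ∧ ∃ x ∈ Y, ∃ y ∈ Y, x ≠ y ∧
      ReflTransGen E u (ℓ x) ∧ ReflTransGen E u (ℓ y)) ⟨v, .refl, h2⟩
  have key : ∀ x ∈ Y, ∀ y ∈ Y, ReflTransGen E u (ℓ x) → ReflTransGen E u (ℓ y) →
      ∀ C ∈ 𝒞, x ∈ C → y ∉ C → ∀ z ∈ Y, z ∈ C → z = x := by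
    intro x hx y hy hux huy C hC hxC hyC z hz hzC
    by_contra hzx
    obtain ⟨σ, hσ, p, hpx, hpz, hpy⟩ := hsep C hC x hx z hz y hy (Ne.symm hzx) hxC hzC hyC
    have hS : ∀ w, ReflTransGen E u w → SR E σ u w := by
      intro w hw
      induction hw with
      | refl => exact .refl
      | tail hb hbc ih =>
        refine ReflTransGen.tail ih ⟨hbc, ?_⟩
        exact hv _ (TransGen.tail' (hvu.trans hb) hbc) _ _ (hσ _ ⟨_, hbc⟩) hbc
    rcases rtg_comparable (r := fun a b => E a b ∧ σ b = a)
      (fun a b c h1 h2 => h1.2.symm.trans h2.2) hpx (hS _ hux) with h | h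
    · exact hpy (ReflTransGen.trans h (hS _ huy))
    · have h' : ReflTransGen E u p := SR.reach h
      rcases reflTransGen_iff_eq_or_transGen.1 h' with h'' | h''
      · subst h''; exact hpy (hS _ huy)
      · exact hlow p h'' ⟨hvu.trans h', x, hx, z, hz, Ne.symm hzx, SR.reach hpx, SR.reach hpz⟩
  exact ⟨x, hx, y, hy, hxy, key x hx y hy hux huy, key y hy x hx huy hux⟩

theorem lower_bound [Fintype V] (ℓ : α → V) (r0 : V) (𝒞 : Set (Finset α)) :
    ∀ (m : ℕ) (E : Finset (V × V)) (Y : Finset α) (k : ℕ), E.card + Y.card ≤ m → Y.Nonempty →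
    (∀ v, ¬ TransGen (fun a b => (a, b) ∈ E) v v) →
    (∀ y ∈ Y, ReflTransGen (fun a b => (a, b) ∈ E) r0 (ℓ y)) →
    (∑ v, ((E.filter fun e => e.2 = v).card - 1) ≤ k) →
    (∀ C ∈ 𝒞, ∀ x ∈ Y, ∀ z ∈ Y, ∀ y ∈ Y, x ≠ z → x ∈ C → z ∈ C → y ∉ C →
      Sep (fun a b => (a, b) ∈ E) ℓ x z y) → Red 𝒞 Y k := by
  intro m
  induction m with
  | zero =>
    intro E Y k h hY
    have := hY.card_pos
    omega
  | succ m ih =>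
    intro E Y k hcard hY hac hreach hsum hsep
    by_cases h1 : ∃ x, Y = {x}
    · obtain ⟨x, rfl⟩ := h1; exact .single x k
    have hner : ∀ x, x ∈ Y → (Y.erase x).Nonempty := by
      intro x hx
      by_contra h
      rw [Finset.not_nonempty_iff_eq_empty, Finset.erase_eq_empty_iff] at h
      rcases h with h | h
      · simp [h] at hx
      · exact h1 ⟨x, h⟩
    have hcherry : ∀ v, (∀ w, TransGen (fun a b => (a, b) ∈ E) v w → ∀ a b, (a, w) ∈ E → (b, w) ∈ E → a = b) →
        (∃ x ∈ Y, ∃ y ∈ Y, x ≠ y ∧ ReflTransGen (fun a b => (a, b) ∈ E) v (ℓ x) ∧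
          ReflTransGen (fun a b => (a, b) ∈ E) v (ℓ y)) → Red 𝒞 Y k := by
      intro v hv h2
      obtain ⟨x, hx, y, hy, hxy, c1, c2⟩ := cherry_of_tree hac ℓ Y 𝒞 hsep v hv h2
      refine .cherry Y x y k hx hy hxy c1 c2 (ih E _ k ?_ (hner x hx) hac ?_ hsum ?_)
      · rw [Finset.card_erase_of_mem hx]
        have := hY.card_pos
        omega
      · intro y hy; exact hreach y (Finset.mem_of_mem_erase hy)
      · intro C hC x hx z hz y hy
        exact hsep C hC x (Finset.mem_of_mem_erase hx) z (Finset.mem_of_mem_erase hz) y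
          (Finset.mem_of_mem_erase hy)
    by_cases hret : ∃ v, ∃ a b, a ≠ b ∧ (a, v) ∈ E ∧ (b, v) ∈ E
    · obtain ⟨v, ⟨a, b, hab, hav, hbv⟩, hlow⟩ := exists_lowest hac _ hret
      by_cases h2 : ∃ x ∈ Y, ∃ y ∈ Y, x ≠ y ∧ ReflTransGen (fun a b => (a, b) ∈ E) v (ℓ x) ∧
          ReflTransGen (fun a b => (a, b) ∈ E) v (ℓ y)
      · refine hcherry v ?_ h2
        intro w hw a b ha hb
        by_contra hne
        exact hlow w hw ⟨a, b, hne, ha, hb⟩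
      · set E' := E.filter (fun e => e.2 ≠ v) with hE'
        have hsub : ∀ a b, (a, b) ∈ E' → (a, b) ∈ E := fun a b h => (Finset.mem_filter.1 h).1
        have hac' : ∀ v, ¬ TransGen (fun a b => (a, b) ∈ E') v v :=
          fun v h => hac v (TransGen.mono hsub _ _ h)
        have hlt : E'.card < E.card := by
          apply Finset.card_lt_card
          refine ⟨Finset.filter_subset _ _, fun h => ?_⟩
          have := h hav
          simp [hE'] at this
        have hsum' : ∑ w, ((E'.filter fun e => e.2 = w).card - 1) <
            ∑ w, ((E.filter fun e => e.2 = w).card - 1) := by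
          apply Finset.sum_lt_sum
          · intro w _
            exact Nat.sub_le_sub_right (Finset.card_le_card
              (Finset.filter_subset_filter _ (Finset.filter_subset _ _))) 1
          · refine ⟨v, Finset.mem_univ _, ?_⟩
            have e0 : E'.filter (fun e => e.2 = v) = ∅ := by
              ext e; simp [hE']
            have e2 : 1 < (E.filter fun e => e.2 = v).card := by
              rw [Finset.one_lt_card]
              exact ⟨(a, v), by simp [hav], (b, v), by simp [hbv], by simp [hab]⟩
            rw [e0]; simp; omega
        -- paths to taxa not below v survive
        have hpath : ∀ (σ : V → V → Prop), (∀ a b, σ a b → (a, b) ∈ E) → ∀ y : α,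
            ¬ ReflTransGen (fun a b => (a, b) ∈ E) v (ℓ y) → ∀ p, ReflTransGen σ p (ℓ y) →
            ReflTransGen (fun a b => σ a b ∧ (a, b) ∈ E') p (ℓ y) := by
          intro σ hσ y hy p hp
          induction hp using ReflTransGen.head_induction_on with
          | refl => exact .refl
          | head hab hb ih =>
            refine ReflTransGen.head ⟨hab, ?_⟩ ih
            simp only [hE', Finset.mem_filter]
            refine ⟨hσ _ _ hab, ?_⟩
            rintro rfl
            exact hy (ReflTransGen.mono hσ _ _ hb)
        have main : ∀ Y' ⊆ Y, Y'.Nonempty →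
            (∀ y ∈ Y', ¬ ReflTransGen (fun a b => (a, b) ∈ E) v (ℓ y)) → Red 𝒞 Y' (k - 1) := by
          intro Y' hY' hne hnb
          refine ih E' Y' (k - 1) ?_ hne hac' ?_ (by omega) ?_
          · have := Finset.card_le_card hY'
            omega
          · intro y hy
            exact ReflTransGen.mono (fun _ _ h => h.2) _ _ (hpath _ (fun _ _ h => h) y (hnb y hy) _ (hreach y (hY' hy)))
          · intro C hC x hx z hz y hy hxz hxC hzC hyC
            obtain ⟨σ, hσ, p, hpx, hpz, hpy⟩ := hsep C hC x (hY' hx) z (hY' hz) y (hY' hy) hxz hxC hzC hyC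
            have conv : ∀ w, w ∈ Y' → SR (fun a b => (a, b) ∈ E) σ p (ℓ w) →
                SR (fun a b => (a, b) ∈ E') σ p (ℓ w) := by
              intro w hw h
              exact ReflTransGen.mono (fun _ _ h => ⟨h.2, h.1.2⟩) _ _
                (hpath _ (fun _ _ h => h.1) w (hnb w hw) _ h)
            refine ⟨σ, ?_, p, conv x hx hpx, conv z hz hpz, fun h => hpy ?_⟩
            · rintro b ⟨a, ha⟩
              have ha' := Finset.mem_filter.1 ha
              exact Finset.mem_filter.2 ⟨hσ b ⟨a, ha'.1⟩, ha'.2⟩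
            · exact ReflTransGen.mono (fun _ _ h => ⟨hsub _ _ h.1, h.2⟩) _ _ h
        have hk : k = (k - 1) + 1 := by omega
        by_cases h3 : ∃ x ∈ Y, ReflTransGen (fun a b => (a, b) ∈ E) v (ℓ x)
        · obtain ⟨x, hx, hvx⟩ := h3
          rw [hk]
          refine .del Y x _ hx (hner x hx) (main _ (Finset.erase_subset _ _) (hner x hx) ?_)
          intro y hy hvy
          rw [Finset.mem_erase] at hy
          exact h2 ⟨x, hx, y, hy.2, hy.1.symm, hvx, hvy⟩
        · rw [hk]
          refine (main Y subset_rfl hY ?_).succ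
          intro y hy hvy
          exact h3 ⟨y, hy, hvy⟩
    · refine hcherry r0 ?_ ?_
      · intro w _ a b ha hb
        by_contra hne
        exact hret ⟨w, a, b, hne, ha, hb⟩
      · obtain ⟨x, hx⟩ := hY
        obtain ⟨y, hy⟩ := hner x hx
        rw [Finset.mem_erase] at hy
        exact ⟨x, hx, y, hy.2, hy.1.symm, hreach x hx, hreach y hy.2⟩

end LB
end Phylo

namespace Phylo

section API
open Relation
variable {α : Type}

theorem indeg_eq_zero (N : Net α) (v) : N.indeg v = 0 ↔ ∀ a, ¬ N.Adj a v := by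
  unfold Net.indeg Net.Adj
  rw [Finset.card_eq_zero, Finset.filter_eq_empty_iff]
  constructor
  · intro h a ha; exact h ha rfl
  · rintro h ⟨a, b⟩ hab rfl; exact h a hab

theorem isLeaf_iff (N : Net α) (v) : N.IsLeaf v ↔ ∀ b, ¬ N.Adj v b := by
  unfold Net.IsLeaf Net.outdeg Net.Adj
  rw [Finset.card_eq_zero, Finset.filter_eq_empty_iff]
  constructor
  · intro h a ha; exact h ha rfl
  · rintro h ⟨a, b⟩ hab rfl; exact h b hab

theorem indeg_le_one (N : Net α) (v) :
    N.indeg v ≤ 1 ↔ ∀ a b, N.Adj a v → N.Adj b v → a = b := by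
  unfold Net.indeg Net.Adj
  rw [Finset.card_le_one]
  constructor
  · intro h a b ha hb
    have := h (a, v) (by simp [ha]) (b, v) (by simp [hb])
    simpa using this
  · rintro h ⟨a, v1⟩ h1 ⟨b, v2⟩ h2
    simp only [Finset.mem_filter] at h1 h2
    obtain ⟨h1, rfl⟩ := h1
    obtain ⟨h2, rfl⟩ := h2
    rw [h a b h1 h2]

theorem outdeg_le_one (N : Net α) (v) :
    N.outdeg v ≤ 1 ↔ ∀ a b, N.Adj v a → N.Adj v b → a = b := by
  unfold Net.outdeg Net.Adj
  rw [Finset.card_le_one]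
  constructor
  · intro h a b ha hb
    have := h (v, a) (by simp [ha]) (v, b) (by simp [hb])
    simpa using this
  · rintro h ⟨v1, a⟩ h1 ⟨v2, b⟩ h2
    simp only [Finset.mem_filter] at h1 h2
    obtain ⟨h1, rfl⟩ := h1
    obtain ⟨h2, rfl⟩ := h2
    rw [h a b h1 h2]

theorem reticNum_eq_zero (N : Net α) :
    N.reticNum = 0 ↔ ∀ v a b, N.Adj a v → N.Adj b v → a = b := by
  unfold Net.reticNum
  rw [Finset.sum_eq_zero_iff]
  constructor
  · intro h v
    have := h v (Finset.mem_univ _)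
    exact (indeg_le_one N v).1 (by omega)
  · intro h v _
    have := (indeg_le_one N v).2 (h v)
    omega

theorem root_reaches {V : Type} [Finite V] {E : V → V → Prop} (hac : ∀ v, ¬ TransGen E v v)
    (ρ : V) (h : ∀ v, v ≠ ρ → ∃ a, E a v) (v : V) : ReflTransGen E ρ v := by
  have : IsStrictOrder V (TransGen E) :=
    { irrefl := hac, trans := fun a b c h1 h2 => TransGen.trans h1 h2 }
  have wf : WellFounded (TransGen E) := Finite.wellFounded_of_trans_of_irrefl _
  induction v using wf.induction with
  | _ v ih =>
    by_cases hv : v = ρ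
    · subst hv; exact .refl
    · obtain ⟨a, ha⟩ := h v hv
      exact (ih a (.single ha)).tail ha

theorem rtg_antisymm {V : Type} {E : V → V → Prop} (hac : ∀ v, ¬ TransGen E v v) {a b : V}
    (h1 : ReflTransGen E a b) (h2 : ReflTransGen E b a) : a = b := by
  rcases reflTransGen_iff_eq_or_transGen.1 h1 with h | h
  · exact h.symm
  · exact absurd (h.trans_left h2) (hac a)

theorem IsPhyloNet.root {X : Finset α} {N : Net α} (h : IsPhyloNet X N) :
    ∃ ρ, (∀ a, ¬ N.Adj a ρ) ∧ (∀ v, v ≠ ρ → ∃ a, N.Adj a v) ∧ ∀ v, N.Reaches ρ v := by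
  obtain ⟨hac, ⟨ρ, hρ, huniq⟩, -⟩ := h
  have h1 : ∀ v, v ≠ ρ → ∃ a, N.Adj a v := by
    intro v hv
    by_contra hc
    push Not at hc
    exact hv (huniq v ((indeg_eq_zero N v).2 hc))
  exact ⟨ρ, (indeg_eq_zero N ρ).1 hρ, h1, root_reaches hac ρ h1⟩

theorem IsPhyloNet.leaf {X : Finset α} {N : Net α} (h : IsPhyloNet X N) :
    ∃ ℓ : α → Fin N.n, ∀ x ∈ X, (N.IsLeaf (ℓ x) ∧ N.label (ℓ x) = x ∧
      ∀ v, N.IsLeaf v → N.label v = x → v = ℓ x) := by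
  obtain ⟨ρ, -⟩ := h.root
  obtain ⟨hm, hi, hs⟩ := h.2.2.2.2
  have : ∀ x, ∃ v, x ∈ X → N.IsLeaf v ∧ N.label v = x := by
    intro x
    by_cases hx : x ∈ X
    · obtain ⟨v, hv, hv'⟩ := hs hx
      exact ⟨v, fun _ => ⟨hv, hv'⟩⟩
    · exact ⟨ρ, fun h => absurd h hx⟩
  choose ℓ hℓ using this
  refine ⟨ℓ, fun x hx => ⟨(hℓ x hx).1, (hℓ x hx).2, fun v hv hvx => ?_⟩⟩
  exact hi hv (hℓ x hx).1 (hvx.trans (hℓ x hx).2.symm)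

theorem chain_facts {V : Type} {r : V → V → Prop} (hr : ∀ a b c, r a c → r b c → a = b) :
    ∀ (p : List V) (a b : V), p.head? = some a → p.getLast? = some b → p.IsChain r →
    ReflTransGen r a b ∧ ∀ x, ReflTransGen r x b → x ∈ p.tail ∨ ReflTransGen r x a := by
  intro p
  induction p with
  | nil => simp
  | cons d l ih =>
    intro a b ha hb hch
    simp at ha; subst ha
    cases l with
    | nil => simp at hb; subst hb; exact ⟨.refl, fun x hx => Or.inr hx⟩
    | cons c l =>
      rw [List.isChain_cons_cons] at hch
      obtain ⟨i1, i2⟩ := ih c b rfl (by simpa using hb) hch.2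
      refine ⟨.head hch.1 i1, fun x hx => ?_⟩
      rcases i2 x hx with h | h
      · left; simp at h ⊢; exact Or.inr h
      · rcases ReflTransGen.cases_tail h with h | ⟨e, he, hec⟩
        · left; simp [h]
        · right; rw [← hr _ _ _ hec hch.1]; exact he

theorem displays_switch {X' : Finset α} {N T : Net α} (hac : ∀ v, ¬ TransGen N.Adj v v)
    (hT : IsPhyloTree X' T) (hD : Displays N T) :
    ∃ (φ : Fin T.n → Fin N.n) (σ : Fin N.n → Fin N.n), Spans N.Adj σ ∧
      (∀ v, T.IsLeaf v → N.IsLeaf (φ v) ∧ N.label (φ v) = T.label v) ∧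
      ∀ a b, SR N.Adj σ (φ a) (φ b) ↔ T.Reaches a b := by
  obtain ⟨φ, hinj, hleaf, P, hP, hint, hdisj⟩ := hD
  obtain ⟨ρ, -, -, hρ⟩ := hT.1.root
  have htree := (reticNum_eq_zero T).1 hT.2
  let Cons : Fin T.n × Fin T.n → Fin N.n → Fin N.n → Prop := fun e a w =>
    ∃ (i : ℕ) (h : i + 1 < (P e).length), (P e)[i] = a ∧ (P e)[i+1] = w
  have hch : ∀ e ∈ T.E, (P e).IsChain N.Adj := fun e he => (hP e he).2.2.1
  have hnodup : ∀ e ∈ T.E, (P e).Nodup := by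
    intro e he
    have h1 : (P e).IsChain (TransGen N.Adj) := (hch e he).imp (fun _ _ h => .single h)
    have : (P e).Pairwise (TransGen N.Adj) := List.isChain_iff_pairwise.1 h1
    refine this.imp ?_
    rintro a b hab rfl
    exact hac a hab
  have hcases : ∀ e ∈ T.E, ∀ a w, Cons e a w → w ∈ internals (P e) ∨ w = φ e.2 := by
    rintro e he a w ⟨i, hi, -, rfl⟩
    by_cases h : i + 2 < (P e).length
    · left
      unfold internals
      rw [List.mem_iff_getElem]
      refine ⟨i, by simp; omega, by simp⟩
    · right
      have := (hP e he).2.1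
      rw [List.getLast?_eq_getElem?] at this
      have h2 : (P e).length - 1 = i + 1 := by omega
      rw [h2, List.getElem?_eq_getElem hi] at this
      simpa using this
  have huniq : ∀ e ∈ T.E, ∀ f ∈ T.E, ∀ a b w, Cons e a w → Cons f b w → a = b := by
    intro e he f hf a b w h1 h2
    by_cases hef : e = f
    · subst hef
      obtain ⟨i, hi, rfl, hw⟩ := h1
      obtain ⟨j, hj, rfl, hw'⟩ := h2
      have := (hnodup e he).getElem_inj_iff.1 (hw.trans hw'.symm)
      have : i = j := by omega
      subst this; rfl
    · exfalso
      rcases hcases e he a w h1 with h | h <;> rcases hcases f hf b w h2 with h' | h'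
      · exact hdisj e he f hf hef w h h'
      · exact hint e he w h ⟨_, h'.symm⟩
      · exact hint f hf w h' ⟨_, h.symm⟩
      · have h3 := hinj (h.symm.trans h')
        apply hef
        obtain ⟨e1, e2⟩ := e
        obtain ⟨f1, f2⟩ := f
        simp only at h3; subst h3
        rw [htree _ _ _ he hf]
  have hσ : ∃ σ : Fin N.n → Fin N.n, Spans N.Adj σ ∧ ∀ e ∈ T.E, ∀ a w, Cons e a w → σ w = a := by
    have : ∀ w, ∃ s, ((∃ a, N.Adj a w) → N.Adj s w) ∧ ∀ e ∈ T.E, ∀ a, Cons e a w → s = a := by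
      intro w
      by_cases h : ∃ e ∈ T.E, ∃ a, Cons e a w
      · obtain ⟨e, he, a, hc⟩ := h
        refine ⟨a, fun _ => ?_, fun f hf b hb => huniq e he f hf a b w hc hb⟩
        obtain ⟨i, hi, rfl, rfl⟩ := hc
        exact List.isChain_iff_getElem.1 (hch e he) i hi
      · by_cases h' : ∃ a, N.Adj a w
        · exact ⟨h'.choose, fun _ => h'.choose_spec, fun e he a hc => absurd ⟨e, he, a, hc⟩ h⟩
        · exact ⟨w, fun h => absurd h h', fun e he a hc => absurd ⟨e, he, a, hc⟩ h⟩
    choose σ h1 h2 using this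
    exact ⟨σ, h1, fun e he a w => h2 w e he a⟩
  obtain ⟨σ, hspan, hσ⟩ := hσ
  refine ⟨φ, σ, hspan, hleaf, ?_⟩
  have hch' : ∀ e ∈ T.E, (P e).IsChain (fun a b => N.Adj a b ∧ σ b = a) := by
    intro e he
    rw [List.isChain_iff_getElem]
    intro i hi
    exact ⟨List.isChain_iff_getElem.1 (hch e he) i hi, hσ e he _ _ ⟨i, hi, rfl, rfl⟩⟩
  have hfacts := fun e he => chain_facts (r := fun a b => N.Adj a b ∧ σ b = a)
    (fun a b c h1 h2 => h1.2.symm.trans h2.2) (P e) _ _ (hP e he).1 (hP e he).2.1 (hch' e he)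
  have fwd : ∀ a b, T.Reaches a b → SR N.Adj σ (φ a) (φ b) := by
    intro a b h
    induction h with
    | refl => exact .refl
    | tail hb hbc ih => exact ReflTransGen.trans ih (hfacts _ hbc).1
  intro a b
  refine ⟨?_, fwd a b⟩
  have hb := hρ b
  induction hb with
  | refl =>
    intro h
    have := rtg_antisymm hac (SR.reach h) (SR.reach (fwd _ _ (hρ a)))
    rw [hinj this]; exact .refl
  | @tail c b hc hcb ih =>
    intro h
    rcases (hfacts _ hcb).2 _ h with h | h
    · rw [List.mem_iff_getElem] at h
      obtain ⟨i, hi, hia⟩ := h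
      have hi' : i + 1 < (P (c, b)).length := by simp at hi; omega
      rcases hcases (c, b) hcb (P (c, b))[i] (φ a) ⟨i, hi', rfl, by simpa using hia⟩ with h | h
      · exact absurd ⟨a, rfl⟩ (hint _ hcb _ h)
      · rw [hinj h]; exact .refl
    · exact (ih h).tail hcb

end API
end Phylo

namespace Phylo

section Trip
open Relation
variable {α : Type}

theorem exists_path {N : Net α} {s : Fin N.n → Fin N.n → Prop} (hs : ∀ a b, s a b → N.Adj a b)
    {a b : Fin N.n} (h : TransGen s a b) :
    ∃ p, IsDirPath N a b p ∧ ∀ u ∈ internals p, TransGen s a u ∧ TransGen s u b := by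
  induction h using TransGen.head_induction_on with
  | single h =>
    rename_i a
    refine ⟨[a, b], ⟨rfl, rfl, ?_, by simp⟩, by simp [internals]⟩
    exact List.isChain_pair.2 (hs _ _ h)
  | head hac hcb ih =>
    rename_i a c
    obtain ⟨p, ⟨h1, h2, h3, h4⟩, hp⟩ := ih
    obtain _ | ⟨c', _ | ⟨d, q⟩⟩ := p
    · simp at h4
    · simp at h4
    · simp at h1; subst h1
      refine ⟨a :: c' :: d :: q, ⟨rfl, by simpa using h2, ?_, by simp⟩, ?_⟩
      · exact List.isChain_cons_cons.2 ⟨hs _ _ hac, h3⟩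
      · intro u hu
        have : u = c' ∨ u ∈ internals (c' :: d :: q) := by
          simpa [internals] using hu
        rcases this with rfl | h
        · exact ⟨.single hac, hcb⟩
        · exact ⟨.head hac (hp u h).1, (hp u h).2⟩

theorem displays_of {N T : Net α} (htree : ∀ v a b, T.Adj a v → T.Adj b v → a = b)
    (φ : Fin T.n → Fin N.n) (hinj : Function.Injective φ)
    (hleaf : ∀ v, T.IsLeaf v → N.IsLeaf (φ v) ∧ N.label (φ v) = T.label v)
    (I : Fin T.n → Fin N.n → Prop)
    (hP : ∀ a b, T.Adj a b → ∃ p, IsDirPath N (φ a) (φ b) p ∧ ∀ u ∈ internals p, I b u)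
    (h1 : ∀ b u, I b u → ∀ w, u ≠ φ w) (h2 : ∀ b c u, I b u → I c u → b = c) :
    Displays N T := by
  have : ∀ e : Fin T.n × Fin T.n, ∃ p, e ∈ T.E →
      (IsDirPath N (φ e.1) (φ e.2) p ∧ ∀ u ∈ internals p, I e.2 u) := by
    rintro ⟨a, b⟩
    by_cases h : (a, b) ∈ T.E
    · obtain ⟨p, hp⟩ := hP a b h
      exact ⟨p, fun _ => hp⟩
    · exact ⟨[], fun h' => absurd h' h⟩
  choose P hP using this
  refine ⟨φ, hinj, hleaf, P, fun e he => (hP e he).1, ?_, ?_⟩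
  · rintro e he w hw ⟨v, rfl⟩
    exact h1 _ _ ((hP e he).2 _ hw) v rfl
  · rintro ⟨a, b⟩ he ⟨c, d⟩ hf hne w hw hw'
    have hbd := h2 _ _ _ ((hP _ he).2 _ hw) ((hP _ hf).2 _ hw')
    simp only at hbd; subst hbd
    exact hne (by rw [htree _ _ _ he hf])

def t5 (x y z : α) : Net α where
  n := 5
  E := {(0, 1), (1, 2), (1, 3), (0, 4)}
  label := ![x, x, x, y, z]

theorem t5_adj (x y z : α) (a b : Fin 5) : (t5 x y z).Adj a b ↔
    (a = 0 ∧ b = 1) ∨ (a = 1 ∧ b = 2) ∨ (a = 1 ∧ b = 3) ∨ (a = 0 ∧ b = 4) := by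
  unfold Net.Adj t5
  simp

theorem t5_leaf (x y z : α) (a : Fin 5) : (t5 x y z).IsLeaf a ↔ a = 2 ∨ a = 3 ∨ a = 4 := by
  have : ∀ a : Fin 5, (({(0, 1), (1, 2), (1, 3), (0, 4)} : Finset (Fin 5 × Fin 5)).filter fun e => e.1 = a).card = 0 ↔
      a = 2 ∨ a = 3 ∨ a = 4 := by decide
  exact this a

theorem t5_in (x y z : α) (a : Fin 5) : (t5 x y z).indeg a = ![0, 1, 1, 1, 1] a := by
  have : ∀ a : Fin 5, (({(0, 1), (1, 2), (1, 3), (0, 4)} : Finset (Fin 5 × Fin 5)).filter fun e => e.2 = a).card =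
      ![0, 1, 1, 1, 1] a := by decide
  exact this a

theorem t5_out (x y z : α) (a : Fin 5) : (t5 x y z).outdeg a = ![2, 2, 0, 0, 0] a := by
  have : ∀ a : Fin 5, (({(0, 1), (1, 2), (1, 3), (0, 4)} : Finset (Fin 5 × Fin 5)).filter fun e => e.1 = a).card =
      ![2, 2, 0, 0, 0] a := by decide
  exact this a

theorem t5_tree [DecidableEq α] {x y z : α} (hxy : x ≠ y) (hyz : y ≠ z) (hxz : x ≠ z) :
    IsPhyloTree ({x, y, z} : Finset α) (t5 x y z) := by
  have hi : ∀ a : Fin 5, (t5 x y z).indeg a = ![0, 1, 1, 1, 1] a := t5_in x y z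
  have ho : ∀ a : Fin 5, (t5 x y z).outdeg a = ![2, 2, 0, 0, 0] a := t5_out x y z
  refine ⟨⟨?_, ⟨(0 : Fin 5), hi 0, ?_⟩, ?_, ?_, ?_, ?_, ?_⟩, ?_⟩
  · have : ∀ a b : Fin 5, TransGen (t5 x y z).Adj a b → a < b := by
      intro a b h
      have hlt : ∀ a b : Fin 5, (t5 x y z).Adj a b → a < b := by
        intro a b; rw [t5_adj]; revert a b; decide
      induction h with
      | single h => exact hlt _ _ h
      | tail _ h ih => exact lt_trans ih (hlt _ _ h)
    intro v h
    exact lt_irrefl _ (this v v h)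
  · intro v h
    change (t5 x y z).indeg v = 0 at h
    rw [hi v] at h
    have : ∀ v : Fin 5, (![0, 1, 1, 1, 1] v : ℕ) = 0 → v = 0 := by decide
    exact this v h
  · intro v; rw [hi v, ho v]
    have : ∀ v : Fin 5, ¬ ((![0, 1, 1, 1, 1] v : ℕ) = 1 ∧ (![2, 2, 0, 0, 0] v : ℕ) = 1) := by decide
    exact this v
  · intro v; rw [hi v]
    have : ∀ v : Fin 5, ¬ 2 ≤ (![0, 1, 1, 1, 1] v : ℕ) := by decide
    exact fun h => absurd h (this v)
  · intro v hv
    have hv' := (t5_leaf x y z v).1 hv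
    rcases hv' with rfl | rfl | rfl <;> simp [t5]
  · intro v hv w hw h
    have hv' := (t5_leaf x y z v).1 hv
    have hw' := (t5_leaf x y z w).1 hw
    rcases hv' with rfl | rfl | rfl <;> rcases hw' with rfl | rfl | rfl <;>
      simp_all [t5]
  · intro a ha
    simp at ha
    rcases ha with rfl | rfl | rfl
    · exact ⟨(2 : Fin 5), (t5_leaf _ _ _ _).2 (by simp), rfl⟩
    · exact ⟨(3 : Fin 5), (t5_leaf _ _ _ _).2 (by simp), rfl⟩
    · exact ⟨(4 : Fin 5), (t5_leaf _ _ _ _).2 (by simp), rfl⟩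
  · unfold Net.reticNum
    apply Finset.sum_eq_zero
    intro v _
    rw [hi v]
    have : ∀ v : Fin 5, (![0, 1, 1, 1, 1] v : ℕ) - 1 = 0 := by decide
    exact this v

theorem t5_binary (x y z : α) : IsBinary (t5 x y z) := by
  have hi : ∀ a : Fin 5, (t5 x y z).indeg a = ![0, 1, 1, 1, 1] a := t5_in x y z
  have ho : ∀ a : Fin 5, (t5 x y z).outdeg a = ![2, 2, 0, 0, 0] a := t5_out x y z
  intro v
  rw [hi v, ho v]
  have : ∀ v : Fin 5, ((![0, 1, 1, 1, 1] v : ℕ) ≤ 1 → (![2, 2, 0, 0, 0] v : ℕ) = 0 ∨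
    (![2, 2, 0, 0, 0] v : ℕ) = 2) ∧ (2 ≤ (![0, 1, 1, 1, 1] v : ℕ) →
    (![0, 1, 1, 1, 1] v : ℕ) = 2 ∧ (![2, 2, 0, 0, 0] v : ℕ) = 1) := by decide
  exact this v

theorem t5_cluster [DecidableEq α] (x y z : α) :
    ∃ e ∈ (t5 x y z).E, (t5 x y z).clusterBelow e.2 = ({x, y} : Finset α) := by
  refine ⟨((0 : Fin 5), (1 : Fin 5)), (t5_adj x y z 0 1).2 (by simp), ?_⟩
  have h1 : ∀ w : Fin 5, (t5 x y z).Reaches (1 : Fin 5) w → w = 1 ∨ w = 2 ∨ w = 3 := by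
    intro w h
    induction h with
    | refl => left; rfl
    | tail _ h ih =>
      rename_i b c _
      have h' := (t5_adj x y z b c).1 h
      have : ∀ b c : Fin 5, (b = 1 ∨ b = 2 ∨ b = 3) → ((b = 0 ∧ c = 1) ∨ (b = 1 ∧ c = 2) ∨
        (b = 1 ∧ c = 3) ∨ (b = 0 ∧ c = 4)) → (c = 1 ∨ c = 2 ∨ c = 3) := by decide
      exact this b c ih h'
  ext a
  simp only [Net.clusterBelow, Finset.mem_image, Finset.mem_filter, Finset.mem_univ, true_and,
    Finset.mem_insert, Finset.mem_singleton]
  constructor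
  · rintro ⟨w, ⟨hr, hl⟩, rfl⟩
    have hl' := (t5_leaf x y z w).1 hl
    rcases h1 w hr with rfl | rfl | rfl
    · simp at hl'
    · left; rfl
    · right; rfl
  · rintro (rfl | rfl)
    · exact ⟨(2 : Fin 5), ⟨.single ((t5_adj _ _ _ _ _).2 (by simp)), (t5_leaf _ _ _ _).2 (by simp)⟩, rfl⟩
    · exact ⟨(3 : Fin 5), ⟨.single ((t5_adj _ _ _ _ _).2 (by simp)), (t5_leaf _ _ _ _).2 (by simp)⟩, rfl⟩

theorem leaf_rtg {N : Net α} {s : Fin N.n → Fin N.n → Prop} (hs : ∀ a b, s a b → N.Adj a b)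
    {a b : Fin N.n} (ha : N.IsLeaf a) (h : ReflTransGen s a b) : b = a := by
  rcases ReflTransGen.cases_head h with h | ⟨c, hc, -⟩
  · exact h.symm
  · exact absurd (hs _ _ hc) ((isLeaf_iff N a).1 ha c)

theorem triplet_of_switch [DecidableEq α] {N : Net α} (hac : ∀ v, ¬ TransGen N.Adj v v)
    {s : Fin N.n → Fin N.n → Prop} (hs : ∀ a b, s a b → N.Adj a b)
    (hu : ∀ a b c, s a c → s b c → a = b) (r : Fin N.n) (hr : ∀ v, ReflTransGen s r v)
    {x y z : α} (hxy : x ≠ y) (hyz : y ≠ z) (hxz : x ≠ z) {x' y' z' p : Fin N.n}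
    (hx : N.IsLeaf x' ∧ N.label x' = x) (hy : N.IsLeaf y' ∧ N.label y' = y)
    (hz : N.IsLeaf z' ∧ N.label z' = z)
    (hpx : ReflTransGen s p x') (hpy : ReflTransGen s p y') (hpz : ¬ ReflTransGen s p z') :
    ConsistentTriplet N x y z := by
  have hacs : ∀ v, ¬ TransGen s v v := fun v h => hac v (TransGen.mono hs _ _ h)
  have nexy : x' ≠ y' := by rintro rfl; exact hxy (hx.2.symm.trans hy.2)
  have neyz : y' ≠ z' := by rintro rfl; exact hyz (hy.2.symm.trans hz.2)
  have nexz : x' ≠ z' := by rintro rfl; exact hxz (hx.2.symm.trans hz.2)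
  obtain ⟨m, ⟨hpm, hmx, hmy⟩, hmlow⟩ := exists_lowest hacs
    (fun v => ReflTransGen s p v ∧ ReflTransGen s v x' ∧ ReflTransGen s v y') ⟨p, .refl, hpx, hpy⟩
  have hmz : ¬ ReflTransGen s m z' := fun h => hpz (hpm.trans h)
  obtain ⟨M, ⟨hMx, hMy, hMz⟩, hMlow⟩ := exists_lowest hacs
    (fun v => ReflTransGen s v x' ∧ ReflTransGen s v y' ∧ ReflTransGen s v z') ⟨r, hr _, hr _, hr _⟩
  have hMm : ReflTransGen s M m := by
    rcases rtg_comparable hu hMx hmx with h | h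
    · exact h
    · exact absurd (h.trans hMz) hmz
  have tg : ∀ {a b}, ReflTransGen s a b → a ≠ b → TransGen s a b := by
    intro a b h hne
    rcases reflTransGen_iff_eq_or_transGen.1 h with h | h
    · exact absurd h.symm hne
    · exact h
  let prof : Fin N.n → Bool × Bool × Bool := fun u =>
    (decide (ReflTransGen s u x'), decide (ReflTransGen s u y'), decide (ReflTransGen s u z'))
  let φ : Fin 5 → Fin N.n := ![M, m, x', y', z']
  let tp : Fin 5 → Bool × Bool × Bool := ![(true, true, true), (true, true, false),
    (true, false, false), (false, true, false), (false, false, true)]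
  have htp : Function.Injective tp := by
    decide
  have hl : ∀ {a b}, N.IsLeaf a → a ≠ b → ¬ ReflTransGen s a b :=
    fun ha hne h => hne (leaf_rtg hs ha h).symm
  have hφ : ∀ i, prof (φ i) = tp i := by
    intro i
    fin_cases i
    · simp [prof, φ, tp, hMx, hMy, hMz]
    · simp [prof, φ, tp, hmx, hmy, hmz]
    · simp [prof, φ, tp, hl hx.1 nexy, hl hx.1 nexz, ReflTransGen.refl]
    · simp [prof, φ, tp, hl hy.1 nexy.symm, hl hy.1 neyz, ReflTransGen.refl]
    · simp [prof, φ, tp, hl hz.1 nexz.symm, hl hz.1 neyz.symm, ReflTransGen.refl]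
  have hφinj : Function.Injective φ := by
    intro a b h
    apply htp
    rw [← hφ, ← hφ, h]
  refine ⟨t5 x y z, t5_tree hxy hyz hxz, t5_binary x y z, t5_cluster x y z, ?_⟩
  refine displays_of ((reticNum_eq_zero _).1 (t5_tree hxy hyz hxz).2) φ hφinj ?_
    (fun (b : Fin 5) u => prof u = tp b ∧ u ≠ φ b) ?_ ?_ ?_
  · intro v hv
    have hv' := (t5_leaf x y z v).1 hv
    rcases hv' with rfl | rfl | rfl
    · exact hx
    · exact hy
    · exact hz
  · intro a b hab
    have hab' := (t5_adj x y z a b).1 hab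
    have ne : ∀ {u w}, TransGen s u w → u ≠ w := by rintro u w h rfl; exact hacs _ h
    rcases hab' with ⟨rfl, rfl⟩ | ⟨rfl, rfl⟩ | ⟨rfl, rfl⟩ | ⟨rfl, rfl⟩
    · have hne : M ≠ m := by rintro rfl; exact hmz hMz
      obtain ⟨q, hq, hI⟩ := exists_path hs (tg hMm hne)
      refine ⟨q, hq, fun u hu' => ⟨?_, ne (hI u hu').2⟩⟩
      have hum := (hI u hu').2.to_reflTransGen
      have hMu := hMlow u (hI u hu').1
      have hux := hum.trans hmx
      have huy := hum.trans hmy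
      have huz : ¬ ReflTransGen s u z' := fun h => hMu ⟨hux, huy, h⟩
      simp [prof, tp, hux, huy, huz]
    · have hne : m ≠ x' := by rintro rfl; exact hl hx.1 nexy hmy
      obtain ⟨q, hq, hI⟩ := exists_path hs (tg hmx hne)
      refine ⟨q, hq, fun u hu' => ⟨?_, ne (hI u hu').2⟩⟩
      have hux := (hI u hu').2.to_reflTransGen
      have hmu := (hI u hu').1.to_reflTransGen
      have huy : ¬ ReflTransGen s u y' := fun h => hmlow u (hI u hu').1 ⟨hpm.trans hmu, hux, h⟩
      have huz : ¬ ReflTransGen s u z' := fun h => hmz (hmu.trans h)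
      simp [prof, tp, hux, huy, huz]
    · have hne : m ≠ y' := by rintro rfl; exact hl hy.1 nexy.symm hmx
      obtain ⟨q, hq, hI⟩ := exists_path hs (tg hmy hne)
      refine ⟨q, hq, fun u hu' => ⟨?_, ne (hI u hu').2⟩⟩
      have huy := (hI u hu').2.to_reflTransGen
      have hmu := (hI u hu').1.to_reflTransGen
      have hux : ¬ ReflTransGen s u x' := fun h => hmlow u (hI u hu').1 ⟨hpm.trans hmu, h, huy⟩
      have huz : ¬ ReflTransGen s u z' := fun h => hmz (hmu.trans h)
      simp [prof, tp, hux, huy, huz]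
    · have hne : M ≠ z' := by rintro rfl; exact hl hz.1 nexz.symm hMx
      obtain ⟨q, hq, hI⟩ := exists_path hs (tg hMz hne)
      refine ⟨q, hq, fun u hu' => ⟨?_, ne (hI u hu').2⟩⟩
      have huz := (hI u hu').2.to_reflTransGen
      have hlow := hMlow u (hI u hu').1
      have hum : ¬ ReflTransGen s u m := fun h => hlow ⟨h.trans hmx, h.trans hmy, huz⟩
      have hux : ¬ ReflTransGen s u x' := by
        intro h
        rcases rtg_comparable hu h hmx with h' | h'
        · exact hum h'
        · exact hmz (h'.trans huz)
      have huy : ¬ ReflTransGen s u y' := by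
        intro h
        rcases rtg_comparable hu h hmy with h' | h'
        · exact hum h'
        · exact hmz (h'.trans huz)
      simp [prof, tp, hux, huy, huz]
  · rintro b u ⟨h1, h2⟩ w rfl
    exact h2 (congrArg φ (htp ((hφ w).symm.trans h1)))
  · rintro b c u ⟨h1, -⟩ ⟨h2, -⟩
    exact htp (h1.symm.trans h2)

end Trip
end Phylo

namespace Phylo

section Low
open Relation
variable {α : Type}

def LeafMap (X : Finset α) (N : Net α) (ℓ : α → Fin N.n) : Prop :=
  ∀ x ∈ X, (N.IsLeaf (ℓ x) ∧ N.label (ℓ x) = x ∧ ∀ v, N.IsLeaf v → N.label v = x → v = ℓ x)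

theorem IsPhyloNet.exists_leaf {X : Finset α} {N : Net α} (h : IsPhyloNet X N) :
    ∃ v, N.IsLeaf v := by
  obtain ⟨ρ, -⟩ := h.root
  obtain ⟨v, -, hv⟩ := exists_lowest h.1 (fun _ => True) ⟨ρ, trivial⟩
  exact ⟨v, (isLeaf_iff N v).2 fun b hb => hv b (.single hb) trivial⟩

theorem IsPhyloNet.nonempty {X : Finset α} {N : Net α} (h : IsPhyloNet X N) : X.Nonempty := by
  obtain ⟨v, hv⟩ := h.exists_leaf
  exact ⟨_, h.2.2.2.2.1 hv⟩

theorem red_of_sep {X : Finset α} {N : Net α} (h : IsPhyloNet X N) (ℓ : α → Fin N.n)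
    (𝒞 : Set (Finset α))
    (hsep : ∀ C ∈ 𝒞, ∀ x ∈ X, ∀ z ∈ X, ∀ y ∈ X, x ≠ z → x ∈ C → z ∈ C → y ∉ C →
      Sep N.Adj ℓ x z y) : Red 𝒞 X N.reticNum := by
  obtain ⟨ρ, -, -, hρ⟩ := h.root
  refine lower_bound ℓ ρ 𝒞 _ N.E X _ le_rfl h.nonempty h.1 (fun y _ => hρ _) ?_ hsep
  unfold Net.reticNum Net.indeg
  apply le_of_eq
  refine Finset.sum_congr rfl fun v _ => ?_
  congr!

theorem sep_of_display [DecidableEq α] {X X' : Finset α} {N T : Net α} (hX : X' ⊆ X)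
    (h : IsPhyloNet X N) {ℓ : α → Fin N.n} (hℓ : LeafMap X N ℓ) (hT : IsPhyloTree X' T)
    (hD : Displays N T) (v : Fin T.n) (x z y : α) (hx : x ∈ T.clusterBelow v)
    (hz : z ∈ T.clusterBelow v) (hy : y ∈ X') (hyC : y ∉ T.clusterBelow v) :
    Sep N.Adj ℓ x z y := by
  obtain ⟨φ, σ, hσ, hleaf, hR⟩ := displays_switch h.1 hT hD
  have key : ∀ x, x ∈ T.clusterBelow v → SR N.Adj σ (φ v) (ℓ x) := by
    intro x hx
    simp only [Net.clusterBelow, Finset.mem_image, Finset.mem_filter, Finset.mem_univ,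
      true_and] at hx
    obtain ⟨w, ⟨hr, hl⟩, rfl⟩ := hx
    have hm := hT.1.2.2.2.2.1 hl
    have := (hℓ _ (hX hm)).2.2 _ (hleaf w hl).1 (hleaf w hl).2
    rw [← this]
    exact (hR v w).2 hr
  refine ⟨σ, hσ, φ v, key x hx, key z hz, fun hr => hyC ?_⟩
  obtain ⟨w, hw, rfl⟩ := hT.1.2.2.2.2.2.2 hy
  have := (hℓ _ (hX hy)).2.2 _ (hleaf w hw).1 (hleaf w hw).2
  rw [← this] at hr
  simp only [Net.clusterBelow, Finset.mem_image, Finset.mem_filter, Finset.mem_univ, true_and]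
  exact ⟨w, ⟨(hR v w).1 hr, hw⟩, rfl⟩

end Low

section MkNet
open Relation
variable {α : Type}

noncomputable def mkNet (V : Type) [Fintype V] (E : V → V → Prop) (lab : V → α) : Net α where
  n := Fintype.card V
  E := Finset.univ.filter fun p =>
    E ((Fintype.equivFin V).symm p.1) ((Fintype.equivFin V).symm p.2)
  label := fun i => lab ((Fintype.equivFin V).symm i)

variable {V : Type} [Fintype V]

noncomputable def toV (E : V → V → Prop) (lab : V → α) : Fin (mkNet V E lab).n ≃ V :=
  (Fintype.equivFin V).symm

theorem mkNet_adj (E : V → V → Prop) (lab : V → α) (a b) :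
    (mkNet V E lab).Adj a b ↔ E (toV E lab a) (toV E lab b) := by
  unfold Net.Adj mkNet toV
  simp

theorem mkNet_label (E : V → V → Prop) (lab : V → α) (a) :
    (mkNet V E lab).label a = lab (toV E lab a) := rfl

theorem mkNet_leaf (E : V → V → Prop) (lab : V → α) (a) :
    (mkNet V E lab).IsLeaf a ↔ ∀ b, ¬ E (toV E lab a) b := by
  rw [isLeaf_iff]
  simp only [mkNet_adj]
  exact ⟨fun h b => by simpa using h ((toV E lab).symm b), fun h b => h _⟩

theorem mkNet_trans (E : V → V → Prop) (lab : V → α) {a b}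
    (h : TransGen (mkNet V E lab).Adj a b) : TransGen E (toV E lab a) (toV E lab b) := by
  induction h with
  | single h => exact .single ((mkNet_adj _ _ _ _).1 h)
  | tail _ h ih => exact .tail ih ((mkNet_adj _ _ _ _).1 h)

theorem mkNet_reach (E : V → V → Prop) (lab : V → α) {a b} :
    (mkNet V E lab).Reaches a b ↔ ReflTransGen E (toV E lab a) (toV E lab b) := by
  constructor
  · intro h
    induction h with
    | refl => exact .refl
    | tail _ h ih => exact .tail ih ((mkNet_adj _ _ _ _).1 h)
  · intro h
    have : ∀ u v, ReflTransGen E u v →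
        (mkNet V E lab).Reaches ((toV E lab).symm u) ((toV E lab).symm v) := by
      intro u v h
      induction h with
      | refl => exact .refl
      | tail _ h ih => exact .tail ih ((mkNet_adj _ _ _ _).2 (by simpa using h))
    simpa using this _ _ h

structure IsPN (X : Finset α) (E : V → V → Prop) (lab : V → α) (root : V) : Prop where
  acyc : ∀ v, ¬ TransGen E v v
  noPar : ∀ a, ¬ E a root
  par : ∀ b, b ≠ root → ∃ a, E a b
  no11 : ∀ v, v ≠ root → (∃ b, E v b) → (∀ a b, E a v → E b v → a = b) →
    ∃ b c, b ≠ c ∧ E v b ∧ E v c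
  ret : ∀ v, (∃ a b, a ≠ b ∧ E a v ∧ E b v) → ∃ b, E v b
  bij : Set.BijOn lab {v | ∀ b, ¬ E v b} (X : Set α)

theorem IsPN.phylo {X : Finset α} {E : V → V → Prop} {lab : V → α} {root : V}
    (h : IsPN X E lab root) : IsPhyloNet X (mkNet V E lab) := by
  refine ⟨fun v hv => h.acyc _ (mkNet_trans _ _ hv),
    ⟨(toV E lab).symm root, ?_, ?_⟩, ?_, ?_, ?_, ?_, ?_⟩
  · exact (indeg_eq_zero _ _).2 fun a ha => h.noPar _ (by simpa using (mkNet_adj _ _ _ _).1 ha)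
  · intro v hv
    by_contra hne
    have : toV E lab v ≠ root := by
      rintro rfl
      exact hne (by simp)
    obtain ⟨a, ha⟩ := h.par _ this
    exact (indeg_eq_zero _ _).1 hv ((toV E lab).symm a) ((mkNet_adj _ _ _ _).2 (by simpa using ha))
  · rintro v ⟨hi, ho⟩
    have h1 := (indeg_le_one _ _).1 hi.le
    have h2 := (outdeg_le_one _ _).1 ho.le
    have hnr : toV E lab v ≠ root := by
      rintro rfl
      have : (mkNet V E lab).indeg v = 0 :=
        (indeg_eq_zero _ _).2 fun a ha => h.noPar _ ((mkNet_adj _ _ _ _).1 ha)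
      omega
    have hnl : ∃ b, E (toV E lab v) b := by
      by_contra hc
      push Not at hc
      have : (mkNet V E lab).outdeg v = 0 := (mkNet_leaf _ _ _).2 hc
      omega
    obtain ⟨b, c, hbc, hb, hc⟩ := h.no11 _ hnr hnl (by
      intro a b ha hb
      have := h1 ((toV E lab).symm a) ((toV E lab).symm b) ((mkNet_adj _ _ _ _).2 (by simpa using ha))
        ((mkNet_adj _ _ _ _).2 (by simpa using hb))
      simpa using this)
    have := h2 ((toV E lab).symm b) ((toV E lab).symm c) ((mkNet_adj _ _ _ _).2 (by simpa using hb))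
        ((mkNet_adj _ _ _ _).2 (by simpa using hc))
    exact hbc (by simpa using this)
  · intro v hv
    by_contra hc
    have hl : (mkNet V E lab).IsLeaf v := by unfold Net.IsLeaf; omega
    rw [mkNet_leaf] at hl
    have : ¬ (mkNet V E lab).indeg v ≤ 1 := by omega
    rw [indeg_le_one] at this
    push Not at this
    obtain ⟨a, b, ha, hb, hab⟩ := this
    obtain ⟨c, hc⟩ := h.ret (toV E lab v) ⟨toV E lab a, toV E lab b, by simpa using hab,
      (mkNet_adj _ _ _ _).1 ha, (mkNet_adj _ _ _ _).1 hb⟩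
    exact hl c hc
  · intro v hv
    exact h.bij.1 ((mkNet_leaf _ _ _).1 hv)
  · intro v hv w hw hvw
    have := h.bij.2.1 ((mkNet_leaf _ _ _).1 hv) ((mkNet_leaf _ _ _).1 hw) hvw
    exact (toV E lab).injective this
  · intro x hx
    obtain ⟨v, hv, rfl⟩ := h.bij.2.2 hx
    refine ⟨(toV E lab).symm v, (mkNet_leaf _ _ _).2 (by simpa using hv), ?_⟩
    rw [mkNet_label]; simp

theorem mkNet_retic_zero {E : V → V → Prop} {lab : V → α} (h : ∀ v a b, E a v → E b v → a = b) :
    (mkNet V E lab).reticNum = 0 := by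
  rw [reticNum_eq_zero]
  intro v a b ha hb
  exact (toV E lab).injective (h _ _ _ ((mkNet_adj _ _ _ _).1 ha) ((mkNet_adj _ _ _ _).1 hb))

theorem mkNet_retic_le {E : V → V → Prop} {lab : V → α} (R : Finset V)
    (h1 : ∀ v ∉ R, ∀ a b, E a v → E b v → a = b)
    (h2 : ∀ v, ∃ a b, ∀ c, E c v → c = a ∨ c = b) :
    (mkNet V E lab).reticNum ≤ R.card := by
  unfold Net.reticNum
  calc ∑ v, ((mkNet V E lab).indeg v - 1)
      ≤ ∑ v, (if toV E lab v ∈ R then 1 else 0) := by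
        apply Finset.sum_le_sum
        intro v _
        split_ifs with hv
        · obtain ⟨a, b, hab⟩ := h2 (toV E lab v)
          have : (mkNet V E lab).indeg v ≤ 2 := by
            unfold Net.indeg
            refine (Finset.card_le_card (t := {((toV E lab).symm a, v), ((toV E lab).symm b, v)}) ?_).trans
              Finset.card_le_two
            rintro ⟨c, w⟩ hc
            simp only [Finset.mem_filter] at hc
            obtain ⟨hc, rfl⟩ := hc
            have := hab _ ((mkNet_adj _ _ _ _).1 hc)
            simp only [Finset.mem_insert, Finset.mem_singleton, Prod.mk.injEq, and_true]
            rcases this with h | h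
            · left; rw [← h]; simp
            · right; rw [← h]; simp
          omega
        · have := (indeg_le_one (mkNet V E lab) v).2 (by
            intro a b ha hb
            exact (toV E lab).injective
              (h1 _ hv _ _ ((mkNet_adj _ _ _ _).1 ha) ((mkNet_adj _ _ _ _).1 hb)))
          omega
    _ = ∑ v : V, (if v ∈ R then 1 else 0) :=
        Equiv.sum_comp (toV E lab) (fun v => if v ∈ R then 1 else 0)
    _ = R.card := by simp

end MkNet
end Phylo

namespace Phylo

section Sw
open Relation
variable {α : Type}

theorem tree_of_switch [DecidableEq α] {X : Finset α} {N : Net α} (hN : IsPhyloNet X N)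
    {s : Fin N.n → Fin N.n → Prop} (hs : ∀ a b, s a b → N.Adj a b)
    (hu : ∀ a b c, s a c → s b c → a = b) (r : Fin N.n) (hr : ∀ v, ReflTransGen s r v)
    (hrp : ∀ a, ¬ N.Adj a r) :
    ∃ T : Net α, IsPhyloTree X T ∧ Displays N T ∧ ∀ v, v ≠ r → ∀ C : Finset α, C.Nonempty →
      C ⊆ X → (∀ w, N.IsLeaf w → (ReflTransGen s v w ↔ N.label w ∈ C)) → C ∈ clSet T := by
  have hac : ∀ v, ¬ TransGen s v v := fun v h => hN.1 v (TransGen.mono hs _ _ h)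
  let cl : Fin N.n → Set (Fin N.n) := fun v => {w | N.IsLeaf w ∧ ReflTransGen s v w}
  have clmono : ∀ a b, ReflTransGen s a b → cl b ⊆ cl a := fun a b h w hw => ⟨hw.1, h.trans hw.2⟩
  have tg : ∀ a b, ReflTransGen s a b → a ≠ b → TransGen s a b := by
    intro a b h hne
    rcases reflTransGen_iff_eq_or_transGen.1 h with h | h
    · exact absurd h.symm hne
    · exact h
  have hnr : ∀ a b, TransGen s a b → b ≠ r := by
    rintro a b h rfl
    obtain ⟨c, -, hc⟩ := TransGen.tail'_iff.1 h
    exact hrp c (hs _ _ hc)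
  let P : Fin N.n → Prop := fun v => v = r ∨ ((cl v).Nonempty ∧ ∀ u, TransGen s v u → cl u ≠ cl v)
  have hPl : ∀ w, N.IsLeaf w → P w := by
    intro w hw
    refine Or.inr ⟨⟨w, hw, .refl⟩, fun u hu => ?_⟩
    obtain ⟨c, hc, -⟩ := TransGen.head'_iff.1 hu
    exact absurd (hs _ _ hc) ((isLeaf_iff N w).1 hw c)
  have hlow : ∀ v, (cl v).Nonempty → ∃ m, ReflTransGen s v m ∧ P m ∧ cl m = cl v := by
    intro v hv
    obtain ⟨m, ⟨h1, h2⟩, h3⟩ := exists_lowest hac (fun m => ReflTransGen s v m ∧ cl m = cl v)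
      ⟨v, .refl, rfl⟩
    refine ⟨m, h1, Or.inr ⟨h2 ▸ hv, fun u hu he => h3 u hu ⟨h1.trans hu.to_reflTransGen, he.trans h2⟩⟩, h2⟩
  let W := {v : Fin N.n // P v}
  let EW : W → W → Prop := fun a b => TransGen s a.1 b.1 ∧
    ∀ w, P w → TransGen s a.1 w → ¬ TransGen s w b.1
  have par : ∀ b : W, b.1 ≠ r → ∃ a, EW a b := by
    intro b hb
    obtain ⟨a, ⟨h1, h2⟩, h3⟩ := exists_lowest hac (fun a => P a ∧ TransGen s a b.1)
      ⟨r, Or.inl rfl, tg _ _ (hr _) (Ne.symm hb)⟩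
    exact ⟨⟨a, h1⟩, h2, fun w hw haw hwb => h3 w haw ⟨hw, hwb⟩⟩
  have uniq : ∀ (c a b : W), EW a c → EW b c → a = b := by
    intro c a b ha hb
    by_contra hne
    have hne' : a.1 ≠ b.1 := fun h => hne (Subtype.ext h)
    rcases rtg_comparable hu ha.1.to_reflTransGen hb.1.to_reflTransGen with h | h
    · exact ha.2 b.1 b.2 (tg _ _ h hne') hb.1
    · exact hb.2 a.1 a.2 (tg _ _ h hne'.symm) ha.1
  have EWs : ∀ a b, ReflTransGen EW a b → ReflTransGen s a.1 b.1 := by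
    intro a b h
    induction h with
    | refl => exact .refl
    | tail _ h ih => exact ih.trans h.1.to_reflTransGen
  have EWt : ∀ a b, TransGen EW a b → TransGen s a.1 b.1 := by
    intro a b h
    induction h with
    | single h => exact h.1
    | tail _ h ih => exact ih.trans h.1
  have reach : ∀ b a : W, TransGen s a.1 b.1 → ReflTransGen EW a b := by
    have : IsStrictOrder (Fin N.n) (fun a b => TransGen s a b) :=
      { irrefl := hac, trans := fun a b c h1 h2 => TransGen.trans h1 h2 }
    have wf : WellFounded (fun a b : Fin N.n => TransGen s a b) :=
      Finite.wellFounded_of_trans_of_irrefl _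
    have wf' : WellFounded (fun a b : W => TransGen s a.1 b.1) := InvImage.wf Subtype.val wf
    intro b
    induction b using wf'.induction with
    | h b ih =>
    intro a hab
    obtain ⟨a', ha'⟩ := par b (hnr _ _ hab)
    by_cases hne : a = a'
    · subst hne; exact .single ha'
    have hne' : a.1 ≠ a'.1 := fun h => hne (Subtype.ext h)
    rcases rtg_comparable hu hab.to_reflTransGen ha'.1.to_reflTransGen with h | h
    · exact (ih a' ha'.1 a (tg _ _ h hne')).tail ha'
    · exact absurd hab (ha'.2 a.1 a.2 (tg _ _ h hne'.symm))
  have reach' : ∀ a b : W, ReflTransGen s a.1 b.1 → ReflTransGen EW a b := by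
    intro a b h
    by_cases hab : a = b
    · subst hab; exact .refl
    · exact reach b a (tg _ _ h fun h => hab (Subtype.ext h))
  have clne : ∀ v : W, (cl v.1).Nonempty := by
    intro v
    rcases v.2 with h | h
    · obtain ⟨w, hw⟩ := hN.exists_leaf
      exact ⟨w, hw, h ▸ hr w⟩
    · exact h.1
  have leafW : ∀ v : W, (∀ b, ¬ EW v b) ↔ N.IsLeaf v.1 := by
    intro v
    constructor
    · intro h
      obtain ⟨w, hw, hvw⟩ := clne v
      rcases ReflTransGen.cases_head (reach' v ⟨w, hPl w hw⟩ hvw) with h' | ⟨c, hc, -⟩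
      · rw [h']; exact hw
      · exact absurd hc (h c)
    · intro h b hb
      obtain ⟨c, hc, -⟩ := TransGen.head'_iff.1 hb.1
      exact absurd (hs _ _ hc) ((isLeaf_iff N v.1).1 h c)
  have hPN : IsPN X EW (fun v : W => N.label v.1) ⟨r, Or.inl rfl⟩ := by
    refine ⟨fun v h => hac _ (EWt _ _ h), fun a h => hnr _ _ h.1 rfl, fun b hb => par b
      fun h => hb (Subtype.ext h), ?_, ?_, ?_, ?_, ?_⟩
    · rintro v hv ⟨c, hc⟩ -
      have hv' : v.1 ≠ r := fun h => hv (Subtype.ext h)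
      have h2 := (v.2.resolve_left hv').2 c.1 hc.1
      have : ∃ w ∈ cl v.1, w ∉ cl c.1 := by
        by_contra hcon
        push Not at hcon
        exact h2 (Set.Subset.antisymm (clmono _ _ hc.1.to_reflTransGen) hcon)
      obtain ⟨w, hw, hwc⟩ := this
      rcases ReflTransGen.cases_head (reach' v ⟨w, hPl w hw.1⟩ hw.2) with h' | ⟨d, hd, hdw⟩
      · exact absurd hc ((leafW v).2 (by rw [h']; exact hw.1) c)
      · refine ⟨c, d, ?_, hc, hd⟩
        rintro rfl
        exact hwc ⟨hw.1, EWs _ _ hdw⟩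
    · rintro v ⟨a, b, hab, ha, hb⟩
      exact absurd (uniq _ _ _ ha hb) hab
    · intro v hv
      exact hN.2.2.2.2.1 ((leafW v).1 hv)
    · intro v hv w hw hvw
      exact Subtype.ext (hN.2.2.2.2.2.1 ((leafW v).1 hv) ((leafW w).1 hw) hvw)
    · intro x hx
      obtain ⟨w, hw, rfl⟩ := hN.2.2.2.2.2.2 hx
      exact ⟨⟨w, hPl w hw⟩, (leafW _).2 hw, rfl⟩
  refine ⟨mkNet W EW (fun v : W => N.label v.1), ⟨hPN.phylo, mkNet_retic_zero uniq⟩, ?_, ?_⟩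
  · refine displays_of ?_ (fun v => (toV EW (fun v : W => N.label v.1) v).1) ?_ ?_
      (fun b u => ¬ P u ∧ cl u = cl (toV EW (fun v : W => N.label v.1) b).1 ∧
        TransGen s u (toV EW (fun v : W => N.label v.1) b).1) ?_ ?_ ?_
    · intro v a b ha hb
      exact (toV _ _).injective (uniq _ _ _ ((mkNet_adj _ _ _ _).1 ha) ((mkNet_adj _ _ _ _).1 hb))
    · exact Subtype.val_injective.comp (toV _ _).injective
    · intro v hv
      exact ⟨(leafW _).1 ((mkNet_leaf _ _ _).1 hv), rfl⟩
    · intro a b hab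
      have hab := (mkNet_adj _ _ _ _).1 hab
      generalize toV EW (fun v : W => N.label v.1) a = a at *
      generalize toV EW (fun v : W => N.label v.1) b = b at *
      obtain ⟨p, hp, hp2⟩ := exists_path hs hab.1
      refine ⟨p, hp, fun u hu' => ?_⟩
      obtain ⟨hau, hub⟩ := hp2 u hu'
      have hnP : ¬ P u := fun h => hab.2 u h hau hub
      refine ⟨hnP, ?_, hub⟩
      have hsub := clmono _ _ hub.to_reflTransGen
      obtain ⟨m, hum, hPm, hm⟩ := hlow u ((clne b).mono hsub)
      obtain ⟨w, hw⟩ := clne b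
      have hwm : w ∈ cl m := hm ▸ hsub hw
      have hum' : TransGen s u m := tg _ _ hum (by rintro rfl; exact hnP hPm)
      rcases rtg_comparable hu hw.2 hwm.2 with h | h
      · exact Set.Subset.antisymm (hm ▸ clmono _ _ h) hsub
      · by_cases hmb : m = b.1
        · rw [← hm, hmb]
        · exact absurd (tg _ _ h hmb) (hab.2 m hPm (hau.trans hum'))
    · rintro b u ⟨h, -⟩ w rfl
      exact h (Subtype.prop _)
    · rintro b c u ⟨-, h1, h2⟩ ⟨-, h3, h4⟩
      apply (toV _ _).injective
      generalize toV EW (fun v : W => N.label v.1) b = b at *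
      generalize toV EW (fun v : W => N.label v.1) c = c at *
      by_contra hne
      have hne' : b.1 ≠ c.1 := fun h => hne (Subtype.ext h)
      obtain ⟨w, hw⟩ := clne b
      have hwc : w ∈ cl c.1 := by rw [← h3, h1]; exact hw
      rcases rtg_comparable hu hw.2 hwc.2 with h | h
      · exact (b.2.resolve_left (hnr _ _ h2)).2 _ (tg _ _ h hne') (h3.symm.trans h1)
      · exact (c.2.resolve_left (hnr _ _ h4)).2 _ (tg _ _ h hne'.symm) (h1.symm.trans h3)
  · intro v hv C hC hCX hiff
    have hl : ∀ c ∈ C, ∃ w, N.IsLeaf w ∧ N.label w = c := fun c hc => hN.2.2.2.2.2.2 (hCX hc)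
    have hvne : (cl v).Nonempty := by
      obtain ⟨c, hc⟩ := hC
      obtain ⟨w, hw, rfl⟩ := hl c hc
      exact ⟨w, hw, (hiff w hw).2 hc⟩
    obtain ⟨m, hvm, hPm, hm⟩ := hlow v hvne
    have hmr : m ≠ r := by
      by_cases h : v = m
      · exact h ▸ hv
      · exact hnr _ _ (tg _ _ hvm h)
    obtain ⟨a, ha⟩ := par ⟨m, hPm⟩ hmr
    refine ⟨((toV EW (fun v : W => N.label v.1)).symm a,
      (toV EW (fun v : W => N.label v.1)).symm ⟨m, hPm⟩), ?_, ?_⟩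
    · exact (mkNet_adj _ _ _ _).2 (by simpa using ha)
    · ext c
      simp only [Net.clusterBelow, Finset.mem_image, Finset.mem_filter, Finset.mem_univ, true_and]
      constructor
      · rintro ⟨w, ⟨h1, h2⟩, rfl⟩
        have h2 := (leafW _).1 ((mkNet_leaf _ _ _).1 h2)
        have h1 := mkNet_reach _ _ |>.1 h1
        rw [Equiv.apply_symm_apply] at h1
        exact (hiff _ h2).1 (hvm.trans (EWs _ _ h1))
      · intro hc
        obtain ⟨w, hw, rfl⟩ := hl c hc
        have : w ∈ cl m := by rw [hm]; exact ⟨hw, (hiff w hw).2 hc⟩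
        refine ⟨(toV EW (fun v : W => N.label v.1)).symm ⟨w, hPl w hw⟩, ⟨?_, ?_⟩, ?_⟩
        · refine (mkNet_reach _ _).2 ?_
          rw [Equiv.apply_symm_apply, Equiv.apply_symm_apply]
          exact reach' _ _ this.2
        · refine (mkNet_leaf _ _ _).2 ?_
          rw [Equiv.apply_symm_apply]
          exact (leafW _).2 hw
        · rw [mkNet_label, Equiv.apply_symm_apply]

end Sw
end Phylo

namespace Phylo

section PGs
open Relation

/-- A rooted graph in which every vertex has two parents, one for each of the two trees. -/
structure PG (V : Type) where
  root : V
  par : Bool → V → V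
  rank : V → ℕ
  hrank : ∀ i b, b ≠ root → rank (par i b) < rank b

namespace PG
variable {V : Type} (G : PG V)

def step (i : Bool) (a b : V) : Prop := b ≠ G.root ∧ G.par i b = a
def E (a b : V) : Prop := ∃ i, G.step i a b
def R (i : Bool) : V → V → Prop := ReflTransGen (G.step i)
def retic (b : V) : Prop := b ≠ G.root ∧ G.par false b ≠ G.par true b
def ok (S : Set V) (v : V) : Prop :=
  (v ∈ S ∧ v ≠ G.root ∧ (∀ b, ¬ G.E v b) ∧ ¬ G.retic v) ∨
  (v ∉ S ∧ (∃ b, G.E v b) ∧ (v ≠ G.root → ¬ G.retic v → ∃ b c, b ≠ c ∧ G.E v b ∧ G.E v c))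

theorem R_rank {i : Bool} {a b : V} (h : G.R i a b) : G.rank a ≤ G.rank b := by
  induction h with
  | refl => exact le_rfl
  | tail _ h ih =>
    have := G.hrank i _ h.1
    rw [h.2] at this
    omega

theorem R_par {i : Bool} {a b : V} (hb : b ≠ G.root) :
    G.R i a b ↔ a = b ∨ G.R i a (G.par i b) := by
  constructor
  · intro h
    rcases ReflTransGen.cases_tail h with h | ⟨c, h, hc⟩
    · exact Or.inl h.symm
    · right; rw [hc.2]; exact h
  · rintro (rfl | h)
    · exact .refl
    · exact h.tail ⟨hb, rfl⟩

theorem R_root {i : Bool} {a : V} : G.R i a G.root ↔ a = G.root := by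
  constructor
  · intro h
    rcases ReflTransGen.cases_tail h with h | ⟨c, h, hc⟩
    · exact h.symm
    · exact absurd rfl hc.1
  · rintro rfl; exact .refl

theorem R_par' {i : Bool} {a b : V} (hb : b ≠ G.root) :
    G.R i a (G.par i b) ↔ a ≠ b ∧ G.R i a b := by
  rw [G.R_par hb]
  constructor
  · intro h
    refine ⟨?_, Or.inr h⟩
    rintro rfl
    have := G.R_rank h
    have := G.hrank i a hb
    omega
  · rintro ⟨h, h' | h'⟩
    · exact absurd h' h
    · exact h'

theorem R_comp {i : Bool} {p u x : V} (h1 : G.R i p x) (h2 : G.R i u x) :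
    G.R i p u ∨ G.R i u p :=
  rtg_comparable (fun _ _ _ h1 h2 => h1.2.symm.trans h2.2) h1 h2

theorem root_R (i : Bool) (v : V) : G.R i G.root v := by
  induction h : G.rank v using Nat.strong_induction_on generalizing v with
  | _ n ih =>
    by_cases hv : v = G.root
    · subst hv; exact .refl
    · rw [G.R_par hv]
      right
      exact ih _ (h ▸ G.hrank i v hv) _ rfl

theorem R_leaf {i : Bool} {a b : V} (ha : ∀ b, ¬ G.E a b) (h : G.R i a b) : a = b := by
  rcases ReflTransGen.cases_head h with h | ⟨c, hc, -⟩
  · exact h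
  · exact absurd ⟨i, hc⟩ (ha c)

/-- Subdivide the edge from `u` to `v`. -/
noncomputable def sub (u v : V) : PG (Option V) where
  root := some G.root
  par j o := match o with
    | none => some u
    | some b => if b = v ∧ G.par j v = u then none else some (G.par j b)
  rank o := match o with
    | none => 2 * G.rank u + 1
    | some b => 2 * G.rank b
  hrank := by
    rintro i (_ | b) hb
    · simp
    · have hb : b ≠ G.root := fun h => hb (by rw [h])
      have := G.hrank i b hb
      dsimp only
      split_ifs with h
      · obtain ⟨rfl, rfl⟩ := h
        dsimp only
        omega
      · dsimp only
        omega

/-- Add a new childless vertex with parents `a`. -/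
def addV (a : Bool → V) : PG (Option V) where
  root := some G.root
  par j o := match o with
    | none => some (a j)
    | some b => some (G.par j b)
  rank o := match o with
    | none => G.rank (a false) + G.rank (a true) + 1
    | some b => G.rank b
  hrank := by
    rintro i (_ | b) hb
    · cases i <;> dsimp only <;> omega
    · exact G.hrank i b (fun h => hb (by rw [h]))

section Sub
variable {G} {u v : V}

theorem sub_root : (G.sub u v).root = some G.root := rfl
theorem sub_par_none (j) : (G.sub u v).par j none = some u := rfl
theorem sub_par_some (j) (b) : (G.sub u v).par j (some b) =
    if b = v ∧ G.par j v = u then none else some (G.par j b) := rfl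

theorem sub_R_aux (j : Bool) : ∀ n b, G.rank b ≤ n → ∀ a,
    ((G.sub u v).R j (some a) (some b) ↔ G.R j a b) := by
  intro n
  induction n with
  | zero =>
    intro b hb a
    have hb : b = G.root := by
      by_contra h
      have := G.hrank j b h
      omega
    subst hb
    rw [← sub_root (u := u) (v := v), R_root, R_root, sub_root, Option.some_inj]
  | succ n ih =>
    intro b hb a
    by_cases hr : b = G.root
    · subst hr
      rw [← sub_root (u := u) (v := v), R_root, R_root, sub_root, Option.some_inj]
    · have h1 : some b ≠ (G.sub u v).root := by rw [sub_root]; simpa using hr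
      have hlt := G.hrank j b hr
      rw [R_par _ h1, R_par _ hr, sub_par_some, Option.some_inj]
      split_ifs with h
      · obtain ⟨rfl, rfl⟩ := h
        rw [R_par _ (by rw [sub_root]; simp), sub_par_none]
        simp [ih (G.par j b) (by omega) a]
      · rw [ih (G.par j b) (by omega) a]

theorem sub_R (j : Bool) (a b) : (G.sub u v).R j (some a) (some b) ↔ G.R j a b :=
  sub_R_aux j _ b le_rfl a

theorem sub_R_none (j : Bool) (a) : (G.sub u v).R j (some a) none ↔ G.R j a u := by
  rw [R_par _ (by rw [sub_root]; simp), sub_par_none, sub_R]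
  simp

theorem sub_none_R (hv : v ≠ G.root) (j : Bool) (hp : G.par j v = u) (b) :
    (G.sub u v).R j none (some b) ↔ G.R j v b := by
  constructor
  · intro h
    rcases ReflTransGen.cases_head h with h | ⟨c, ⟨hc1, hc2⟩, h⟩
    · cases h
    · cases c with
      | none => rw [sub_par_none] at hc2; cases hc2
      | some c =>
        rw [sub_par_some] at hc2
        split_ifs at hc2 with h'
        rw [← h'.1]
        exact (sub_R j _ _).1 h
  · intro h
    refine ReflTransGen.head ⟨?_, ?_⟩ ((sub_R j _ _).2 h)
    · rw [sub_root]; simpa using hv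
    · rw [sub_par_some, if_pos ⟨rfl, hp⟩]

theorem sub_retic (b) : (G.sub u v).retic (some b) ↔ G.retic b := by
  unfold retic
  rw [sub_root, sub_par_some, sub_par_some]
  split_ifs with h1 h2 h2
  · simp; intro _; rw [h1.1, h1.2, h2.2]
  · have : G.par true v ≠ u := fun h => h2 ⟨h1.1, h⟩
    obtain ⟨rfl, rfl⟩ := h1
    simp [this.symm]
  · have : G.par false v ≠ u := fun h => h1 ⟨h2.1, h⟩
    obtain ⟨rfl, rfl⟩ := h2
    simp [this]
  · simp

theorem sub_retic_none : ¬ (G.sub u v).retic none := by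
  rintro ⟨-, h⟩
  exact h rfl

theorem sub_E {a b} (h : (G.sub u v).E (some a) (some b)) : G.E a b := by
  obtain ⟨j, h1, h2⟩ := h
  rw [sub_par_some] at h2
  split_ifs at h2
  exact ⟨j, fun h => h1 (by rw [sub_root, h]), by simpa using h2⟩

theorem sub_E_none {a} : (G.sub u v).E (some a) none ↔ a = u := by
  constructor
  · rintro ⟨j, -, h⟩
    rw [sub_par_none] at h
    simpa using h.symm
  · rintro rfl
    exact ⟨true, by rw [sub_root]; simp, rfl⟩

theorem sub_none_E (hv : v ≠ G.root) (h : ∃ j, G.par j v = u) : (G.sub u v).E none (some v) := by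
  obtain ⟨j, h⟩ := h
  exact ⟨j, by rw [sub_root]; simpa using hv, by rw [sub_par_some, if_pos ⟨rfl, h⟩]⟩

theorem sub_E_map {a b} (h : G.E a b) :
    (G.sub u v).E (some a) (if a = u ∧ b = v then none else some b) := by
  split_ifs with h'
  · exact sub_E_none.2 h'.1
  · obtain ⟨j, h1, h2⟩ := h
    refine ⟨j, by rw [sub_root]; simpa using h1, ?_⟩
    rw [sub_par_some, if_neg, h2]
    rintro ⟨rfl, h⟩
    exact h' ⟨h2.symm.trans h, rfl⟩

theorem sub_ok (hv : v ≠ G.root) (hu : ∃ j, G.par j v = u) {S : Set V} {a} (h : G.ok S a) :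
    (G.sub u v).ok (some '' S) (some a) := by
  have hm : some a ∈ some '' S ↔ a ∈ S := by simp
  rcases h with ⟨h1, h2, h3, h4⟩ | ⟨h1, ⟨b, h2⟩, h3⟩
  · refine Or.inl ⟨hm.2 h1, by rw [sub_root]; simpa using h2, ?_, fun h => h4 ((sub_retic _).1 h)⟩
    rintro (_ | b) hb
    · rw [sub_E_none] at hb
      obtain ⟨j, hj⟩ := hu
      exact h3 v ⟨j, hv, hj.trans hb.symm⟩
    · exact h3 _ (sub_E hb)
  · refine Or.inr ⟨fun h => h1 (hm.1 h), ⟨_, sub_E_map h2⟩, fun hr hn => ?_⟩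
    obtain ⟨b, c, hbc, hb, hc⟩ := h3 (fun h => hr (by rw [h, sub_root])) (fun h => hn ((sub_retic _).2 h))
    refine ⟨_, _, ?_, sub_E_map hb, sub_E_map hc⟩
    split_ifs with h h' h'
    · exact absurd (h.2.trans h'.2.symm) hbc
    · simp
    · simp
    · simpa using hbc

theorem sub_ncard : {b | (G.sub u v).retic b}.ncard = {b | G.retic b}.ncard := by
  have : {b | (G.sub u v).retic b} = some '' {b | G.retic b} := by
    ext b
    cases b with
    | none => simpa using sub_retic_none
    | some b => simp [sub_retic]
  rw [this, Set.ncard_image_of_injective _ (Option.some_injective _)]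

end Sub

section Add
variable {G} {a : Bool → V}

theorem add_root : (G.addV a).root = some G.root := rfl
theorem add_par_none (j) : (G.addV a).par j none = some (a j) := rfl
theorem add_par_some (j) (b) : (G.addV a).par j (some b) = some (G.par j b) := rfl

theorem add_R (j : Bool) (c b) : (G.addV a).R j (some c) (some b) ↔ G.R j c b := by
  induction h : G.rank b using Nat.strong_induction_on generalizing b with
  | _ n ih =>
    by_cases hr : b = G.root
    · subst hr
      rw [← add_root (a := a), R_root, R_root, add_root, Option.some_inj]
    · rw [R_par _ (by rw [add_root]; simpa using hr), R_par _ hr, add_par_some, Option.some_inj,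
        ih _ (h ▸ G.hrank j b hr) _ rfl]

theorem add_R_none (j : Bool) (c) : (G.addV a).R j (some c) none ↔ G.R j c (a j) := by
  rw [R_par _ (by rw [add_root]; simp), add_par_none, add_R]
  simp

theorem add_none_E (c) : ¬ (G.addV a).E none c := by
  rintro ⟨j, -, h⟩
  cases c <;> cases h

theorem add_none_R (j : Bool) (b) : ¬ (G.addV a).R j none (some b) := by
  intro h
  have := R_leaf _ add_none_E h
  cases this

theorem add_retic (b) : (G.addV a).retic (some b) ↔ G.retic b := by
  unfold retic
  rw [add_root, add_par_some, add_par_some]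
  simp

theorem add_retic_none : (G.addV a).retic none ↔ a false ≠ a true := by
  unfold retic
  rw [add_root, add_par_none, add_par_none]
  simp

theorem add_E (c b) : (G.addV a).E (some c) (some b) ↔ G.E c b := by
  unfold E step
  rw [add_root]
  simp [add_par_some]

theorem add_E_none (c) : (G.addV a).E (some c) none ↔ ∃ j, a j = c := by
  unfold E step
  rw [add_root]
  simp [add_par_none]

theorem add_ok1 {S : Set V} {S' : Set (Option V)} (hS : ∀ v, some v ∈ S' ↔ v ∈ S) {v : V}
    (h : G.ok S v) (hv : ∀ j, a j ≠ v) : (G.addV a).ok S' (some v) := by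
  rcases h with ⟨h1, h2, h3, h4⟩ | ⟨h1, ⟨b, h2⟩, h3⟩
  · refine Or.inl ⟨(hS v).2 h1, by rw [add_root]; simpa using h2, ?_, fun h => h4 ((add_retic _).1 h)⟩
    rintro (_ | b) hb
    · rw [add_E_none] at hb
      obtain ⟨j, hj⟩ := hb
      exact hv j hj
    · exact h3 _ ((add_E _ _).1 hb)
  · refine Or.inr ⟨fun h => h1 ((hS v).1 h), ⟨some b, (add_E _ _).2 h2⟩, fun hr hn => ?_⟩
    obtain ⟨b, c, hbc, hb, hc⟩ := h3 (fun h => hr (by rw [h, add_root])) (fun h => hn ((add_retic _).2 h))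
    exact ⟨some b, some c, by simpa using hbc, (add_E _ _).2 hb, (add_E _ _).2 hc⟩

theorem add_ok2 {S : Set V} {S' : Set (Option V)} (hS : ∀ v, some v ∈ S' ↔ v ∈ S) {v : V}
    (h1 : v ∉ S) (hv : ∃ j, a j = v) (h2 : G.retic v ∨ ∃ b, G.E v b) :
    (G.addV a).ok S' (some v) := by
  refine Or.inr ⟨fun h => h1 ((hS v).1 h), ⟨none, (add_E_none _).2 hv⟩, fun _ hn => ?_⟩
  rcases h2 with h2 | ⟨b, hb⟩
  · exact absurd ((add_retic _).2 h2) hn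
  · exact ⟨none, some b, by simp, (add_E_none _).2 hv, (add_E _ _).2 hb⟩

theorem add_ok3 {S' : Set (Option V)} (h : none ∈ S') (ha : a false = a true) :
    (G.addV a).ok S' none :=
  Or.inl ⟨h, by rw [add_root]; simp, add_none_E, by rw [add_retic_none]; simpa using ha⟩

theorem add_ncard_le : {b | (G.addV a).retic b}.ncard ≤ {b | G.retic b}.ncard + 1 := by
  have : {b | (G.addV a).retic b} ⊆ insert none (some '' {b | G.retic b}) := by
    intro b
    cases b with
    | none => simp
    | some b => simp [add_retic]
  by_cases hf : {b | G.retic b}.Finite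
  · refine (Set.ncard_le_ncard this ((hf.image _).insert _)).trans ?_
    refine (Set.ncard_insert_le _ _).trans ?_
    rw [Set.ncard_image_of_injective _ (Option.some_injective _)]
  · have h2 : {b | (G.addV a).retic b}.Infinite := by
      refine Set.Infinite.mono ?_ (Set.Infinite.image (Option.some_injective V).injOn hf)
      rintro _ ⟨b, hb, rfl⟩
      exact (add_retic b).2 hb
    rw [h2.ncard]; omega

theorem add_ncard_eq (ha : a false = a true) :
    {b | (G.addV a).retic b}.ncard = {b | G.retic b}.ncard := by
  have : {b | (G.addV a).retic b} = some '' {b | G.retic b} := by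
    ext b
    cases b with
    | none => simpa [add_retic_none] using ha
    | some b => simp [add_retic]
  rw [this, Set.ncard_image_of_injective _ (Option.some_injective _)]

end Add

/-- `G'` extends `G` by a new leaf attached above `v i` in the `i`-th tree. -/
structure Ext {V' : Type} (G : PG V) (v : Bool → V) (S : Set V) (d : ℕ) (G' : PG V') (ι : V → V')
    (w : Bool → V') (lf : V') : Prop where
  inj : Function.Injective ι
  hroot : G'.root = ι G.root
  wroot : ∀ i, w i ≠ G'.root
  lroot : lf ≠ G'.root
  lne : ∀ a, lf ≠ ι a
  h1 : ∀ i a b, G'.R i (ι a) (ι b) ↔ G.R i a b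
  h2 : ∀ i a, G'.R i (ι a) lf ↔ a ≠ v i ∧ G.R i a (v i)
  h3 : ∀ i b, G'.R i (w i) (ι b) ↔ G.R i (v i) b
  h4 : ∀ i, G'.R i (w i) lf
  h5 : ∀ i b, ¬ G'.R i lf (ι b)
  okk : ∀ a, G'.ok (insert lf (ι '' S)) a
  card : {b | G'.retic b}.ncard ≤ {b | G.retic b}.ncard + d

theorem ext_cherry (v : V) (S : Set V) (hv : v ≠ G.root) (hr : ¬ G.retic v)
    (hok : ∀ a, G.ok S a) :
    Ext G (fun _ => v) S 0 ((G.sub (G.par false v) v).addV (fun _ => none))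
      (fun a => some (some a)) (fun _ => some none) none := by
  have hp : ∀ i, G.par i v = G.par false v := by
    intro i
    cases i
    · rfl
    · by_contra h
      exact hr ⟨hv, fun h' => h h'.symm⟩
  refine ⟨fun a b h => by simpa using h, rfl, fun i => by rw [add_root, sub_root]; simp,
    by rw [add_root]; simp, fun a => by simp, ?_, ?_, ?_, ?_, ?_, ?_, ?_⟩
  · intro i a b
    rw [add_R, sub_R]
  · intro i a
    rw [add_R_none, sub_R_none, ← hp i, R_par' _ hv]
  · intro i b
    rw [add_R, sub_none_R hv i (hp i)]
  · intro i
    rw [add_R_none]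
    exact .refl
  · intro i b
    exact add_none_R _ _
  · have hS : ∀ b, some b ∈ (insert none ((fun a => some (some a)) '' S) : Set (Option (Option V)))
        ↔ b ∈ some '' S := by
      intro b; simp
    rintro (_ | _ | a)
    · exact add_ok3 (by simp) rfl
    · exact add_ok2 hS (by simp) ⟨true, rfl⟩ (Or.inr ⟨_, sub_none_E hv ⟨false, rfl⟩⟩)
    · exact add_ok1 hS (sub_ok hv ⟨false, rfl⟩ (hok a)) (by simp)
  · rw [add_ncard_eq rfl, sub_ncard]; omega

theorem ext_del (v : Bool → V) (S : Set V) (hv : ∀ i, v i ≠ G.root) (hok : ∀ a, G.ok S a) :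
    ∃ (G' : PG (Option (Option (Option (Option V))))) (w : _) (lf : _),
    Ext G v S 1 G' (fun a => some (some (some (some a)))) w lf := by
  let G1 := G.sub (G.par false (v false)) (v false)
  let G2 := G1.sub (G1.par true (some (v true))) (some (v true))
  let G3 := G2.addV (fun j => if j then none else some none)
  let G4 := G3.addV (fun _ => none)
  have hv1 : some (v true) ≠ G1.root := fun h => hv true (by simpa [G1, sub_root] using h)
  refine ⟨G4, fun j => if j then some (some none) else some (some (some none)), none,
    fun a b h => by simpa using h, rfl, ?_, ?_, fun a => by simp, ?_, ?_, ?_, ?_, ?_, ?_, ?_⟩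
  · rintro (_ | _) h
    · cases h
    · cases h
  · rintro h; cases h
  · intro i a b
    rw [add_R, add_R, sub_R, sub_R]
  · rintro (_ | _) a
    · rw [add_R_none, add_R_none]
      change G2.R false _ (some none) ↔ _
      rw [sub_R, sub_R_none, R_par' _ (hv false)]
    · rw [add_R_none, add_R_none]
      change G2.R true _ none ↔ _
      rw [sub_R_none, R_par' _ hv1, sub_R]
      simp
  · rintro (_ | _) b
    · change G4.R false (some (some (some none))) _ ↔ _
      rw [add_R, add_R, sub_R, sub_none_R (hv false) _ rfl]
    · change G4.R true (some (some none)) _ ↔ _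
      rw [add_R, add_R, sub_none_R hv1 _ rfl, sub_R]
  · rintro (_ | _)
    · change G4.R false (some (some (some none))) _
      rw [add_R_none, add_R_none]
      exact .refl
    · change G4.R true (some (some none)) _
      rw [add_R_none, add_R_none]
      exact .refl
  · intro i b
    exact add_none_R _ _
  · have hS : ∀ b, some b ∈ (insert none ((fun a => some (some (some (some a)))) '' S) :
        Set (Option (Option (Option (Option V))))) ↔ b ∈ some '' (some '' (some '' S)) := by
      intro b; simp [Set.image_image]
    have hS2 : ∀ b, some b ∈ (some '' (some '' (some '' S)) : Set (Option (Option (Option V)))) ↔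
        b ∈ some '' (some '' S) := by
      intro b; simp
    rintro (_ | _ | _ | _ | a)
    · exact add_ok3 (by simp) rfl
    · exact add_ok2 hS (by simp) ⟨true, rfl⟩ (Or.inl (add_retic_none.2 (by simp)))
    · refine add_ok1 hS (add_ok2 hS2 (by simp) ⟨true, rfl⟩ (Or.inr ?_)) (by simp)
      exact ⟨_, sub_none_E hv1 ⟨true, rfl⟩⟩
    · refine add_ok1 hS (add_ok2 hS2 (by simp) ⟨false, rfl⟩ (Or.inr ?_)) (by simp)
      exact ⟨_, sub_E_map (sub_none_E (hv false) ⟨false, rfl⟩)⟩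
    · refine add_ok1 hS (add_ok1 hS2 (sub_ok hv1 ⟨true, rfl⟩
        (sub_ok (hv false) ⟨false, rfl⟩ (hok a))) ?_) (by simp)
      rintro (_ | _) <;> simp
  · have e1 : {b | G4.retic b}.ncard = {b | G3.retic b}.ncard := add_ncard_eq rfl
    have e2 : {b | G3.retic b}.ncard ≤ {b | G2.retic b}.ncard + 1 := add_ncard_le
    have e3 : {b | G2.retic b}.ncard = {b | G1.retic b}.ncard := sub_ncard
    have e4 : {b | G1.retic b}.ncard = {b | G.retic b}.ncard := sub_ncard
    omega

end PG
end PGs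
end Phylo

namespace Phylo

section Bu
open Relation
variable {α : Type}

structure BuiltG (𝒞 : Bool → Set (Finset α)) (Y : Finset α) (k : ℕ) {V : Type} (G : PG V)
    (ℓ : α → V) : Prop where
  inj : ∀ x ∈ Y, ∀ y ∈ Y, ℓ x = ℓ y → x = y
  okk : ∀ v, G.ok {v | ∃ y ∈ Y, ℓ y = v} v
  card : {b | G.retic b}.ncard ≤ k
  cl : ∀ i, ∀ C ∈ 𝒞 i, (∃ z ∈ Y, z ∈ C) →
    ∃ v, v ≠ G.root ∧ ∀ z ∈ Y, (G.R i v (ℓ z) ↔ z ∈ C)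

theorem BuiltG.leaf {𝒞 : Bool → Set (Finset α)} {Y : Finset α} {k : ℕ} {V : Type} {G : PG V}
    {ℓ : α → V} (h : BuiltG 𝒞 Y k G ℓ) {y : α} (hy : y ∈ Y) :
    ℓ y ≠ G.root ∧ (∀ b, ¬ G.E (ℓ y) b) ∧ ¬ G.retic (ℓ y) := by
  rcases h.okk (ℓ y) with h | h
  · exact h.2
  · exact absurd ⟨y, hy, rfl⟩ h.1

theorem built_ext {𝒞 : Bool → Set (Finset α)} {Y : Finset α} {k d : ℕ} {V V' : Type} {G : PG V}
    {ℓ : α → V} {x : α} (hx : x ∈ Y) (h : BuiltG 𝒞 (Y.erase x) k G ℓ)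
    {v : Bool → V} {G' : PG V'} {ι : V → V'} {w : Bool → V'} {lf : V'}
    (hE : PG.Ext G v {v | ∃ y ∈ Y.erase x, ℓ y = v} d G' ι w lf)
    (hcl : ∀ i, ∀ C ∈ 𝒞 i, (∃ z ∈ Y, z ∈ C) →
      (x ∈ C ∧ ∀ z ∈ Y.erase x, z ∉ C) ∨
      (∃ c, c ≠ G.root ∧ (∀ z ∈ Y.erase x, (G.R i c (ℓ z) ↔ z ∈ C)) ∧
        (x ∈ C ↔ c ≠ v i ∧ G.R i c (v i))) ∨
      (x ∈ C ∧ ∀ z ∈ Y.erase x, (G.R i (v i) (ℓ z) ↔ z ∈ C))) :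
    BuiltG 𝒞 Y (k + d) G' (fun z => if z = x then lf else ι (ℓ z)) := by
  have key : ∀ (i : Bool) (C : Finset α) (u : V'), (G'.R i u lf ↔ x ∈ C) →
      (∀ z ∈ Y.erase x, (G'.R i u (ι (ℓ z)) ↔ z ∈ C)) →
      ∀ z ∈ Y, (G'.R i u (if z = x then lf else ι (ℓ z)) ↔ z ∈ C) := by
    intro i C u h1 h2 z hz
    split_ifs with hzx
    · subst hzx; exact h1
    · exact h2 z (Finset.mem_erase.2 ⟨hzx, hz⟩)
  refine ⟨?_, ?_, ?_, ?_⟩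
  · intro a ha b hb hab
    split_ifs at hab with h1 h2 h2
    · rw [h1, h2]
    · exact absurd hab (hE.lne _)
    · exact absurd hab.symm (hE.lne _)
    · exact h.inj a (Finset.mem_erase.2 ⟨h1, ha⟩) b (Finset.mem_erase.2 ⟨h2, hb⟩) (hE.inj hab)
  · intro u
    have : {u | ∃ y ∈ Y, (if y = x then lf else ι (ℓ y)) = u} =
        insert lf (ι '' {v | ∃ y ∈ Y.erase x, ℓ y = v}) := by
      ext u
      simp only [Set.mem_insert_iff, Set.mem_image]
      constructor
      · rintro ⟨y, hy, rfl⟩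
        split_ifs with hyx
        · exact Or.inl rfl
        · exact Or.inr ⟨_, ⟨y, Finset.mem_erase.2 ⟨hyx, hy⟩, rfl⟩, rfl⟩
      · rintro (rfl | ⟨_, ⟨y, hy, rfl⟩, rfl⟩)
        · exact ⟨x, hx, by simp⟩
        · exact ⟨y, Finset.mem_of_mem_erase hy, by simp [Finset.ne_of_mem_erase hy]⟩
    rw [this]
    exact hE.okk u
  · exact hE.card.trans (by have := h.card; omega)
  · intro i C hC hne
    rcases hcl i C hC hne with ⟨hxC, h1⟩ | ⟨c, hc, h1, h2⟩ | ⟨hxC, h1⟩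
    · refine ⟨lf, hE.lroot, key i C _ ⟨fun _ => hxC, fun _ => .refl⟩ fun z hz => ?_⟩
      exact ⟨fun h => absurd h (hE.h5 _ _), fun h => absurd h (h1 z hz)⟩
    · refine ⟨ι c, ?_, key i C _ ?_ fun z hz => ?_⟩
      · rw [hE.hroot]; exact fun h => hc (hE.inj h)
      · rw [hE.h2, h2]
      · rw [hE.h1]; exact h1 z hz
    · refine ⟨w i, hE.wroot i, key i C _ ⟨fun _ => hxC, fun _ => hE.h4 i⟩ fun z hz => ?_⟩
      rw [hE.h3]; exact h1 z hz

theorem built_of_red (X : Finset α) (𝒞 : Bool → Set (Finset α)) (hX : ∀ i, X ∈ 𝒞 i)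
    (hlam : ∀ i, ∀ A ∈ 𝒞 i, ∀ B ∈ 𝒞 i, ∀ z, z ∈ A → z ∈ B → A ⊆ B ∨ B ⊆ A)
    {Y : Finset α} {k : ℕ} (hR : Red (𝒞 false ∪ 𝒞 true) Y k) (hY : Y ⊆ X) :
    ∃ (V : Type) (_ : Fintype V) (G : PG V) (ℓ : α → V), BuiltG 𝒞 Y k G ℓ := by
  have hmem : ∀ i C, C ∈ 𝒞 i → C ∈ 𝒞 false ∪ 𝒞 true := by
    rintro (_ | _) C hC
    · exact Or.inl hC
    · exact Or.inr hC
  induction hR with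
  | single x k =>
    refine ⟨Bool, inferInstance, ⟨false, fun _ _ => false, fun b => if b then 1 else 0, ?_⟩,
      fun _ => true, ?_, ?_, ?_, ?_⟩
    · rintro i (_ | _) h
      · exact absurd rfl h
      · simp
    · simp
    · rintro (_ | _)
      · refine Or.inr ⟨by simp, ⟨true, true, by simp, rfl⟩, by simp⟩
      · refine Or.inl ⟨by simp, by simp, ?_, ?_⟩
        · rintro b ⟨i, -, h⟩; cases h
        · rintro ⟨-, h⟩; exact h rfl
    · have : {b | PG.retic (⟨false, fun _ _ => false, fun b => if b then 1 else 0, by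
          rintro i (_ | _) h
          · exact absurd rfl h
          · simp⟩ : PG Bool) b} = ∅ := by
        ext b
        simp [PG.retic]
      rw [this]; simp
    · rintro i C hC ⟨z, hz, hzC⟩
      refine ⟨true, by simp, fun y hy => ⟨fun _ => ?_, fun _ => .refl⟩⟩
      simp only [Finset.mem_singleton] at hz hy
      rw [hy, ← hz]; exact hzC
  | cherry Y x y k hx hy hxy h1 h2 h ih =>
    obtain ⟨V, _, G, ℓ, hB⟩ := ih ((Finset.erase_subset _ _).trans hY)
    have hyY : y ∈ Y.erase x := Finset.mem_erase.2 ⟨hxy.symm, hy⟩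
    obtain ⟨l1, l2, l3⟩ := hB.leaf hyY
    refine ⟨_, inferInstance, _, _, built_ext (d := 0) hx hB
      (G.ext_cherry (ℓ y) _ l1 l3 hB.okk) ?_⟩
    rintro i C hC hne
    have hleaf : ∀ z ∈ Y.erase x, (G.R i (ℓ y) (ℓ z) ↔ z = y) := by
      intro z hz
      constructor
      · intro hr
        exact (hB.inj _ hyY _ hz (G.R_leaf l2 hr)).symm
      · rintro rfl; exact .refl
    by_cases hxC : x ∈ C
    · by_cases hyC : y ∈ C
      · obtain ⟨c, hc, hc2⟩ := hB.cl i C hC ⟨y, hyY, hyC⟩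
        by_cases hcy : c = ℓ y
        · subst hcy
          exact Or.inr (Or.inr ⟨hxC, hc2⟩)
        · exact Or.inr (Or.inl ⟨c, hc, hc2, ⟨fun _ => ⟨hcy, (hc2 y hyY).2 hyC⟩, fun _ => hxC⟩⟩)
      · refine Or.inl ⟨hxC, fun z hz hzC => ?_⟩
        exact Finset.ne_of_mem_erase hz (h1 C (hmem i C hC) hxC hyC z (Finset.mem_of_mem_erase hz) hzC)
    · by_cases hyC : y ∈ C
      · refine Or.inr (Or.inl ⟨ℓ y, l1, fun z hz => ?_, by simp [hxC]⟩)
        rw [hleaf z hz]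
        refine ⟨fun h => h ▸ hyC, fun h => ?_⟩
        exact h2 C (hmem i C hC) hyC hxC z (Finset.mem_of_mem_erase hz) h
      · obtain ⟨z, hz, hzC⟩ := hne
        obtain ⟨c, hc, hc2⟩ := hB.cl i C hC ⟨z, Finset.mem_erase.2
          ⟨by rintro rfl; exact hxC hzC, hz⟩, hzC⟩
        refine Or.inr (Or.inl ⟨c, hc, hc2, ⟨fun h => absurd h hxC, fun h => ?_⟩⟩)
        exact absurd ((hc2 y hyY).1 h.2) hyC
  | del Y x k hx hne h ih =>
    obtain ⟨V, _, G, ℓ, hB⟩ := ih ((Finset.erase_subset _ _).trans hY)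
    have hmin : ∀ i, ∃ D : Finset α, (D ∈ 𝒞 i ∧ x ∈ D ∧ ∃ z ∈ Y.erase x, z ∈ D) ∧
        ∀ C : Finset α, C ∈ 𝒞 i → x ∈ C → (∃ z ∈ Y.erase x, z ∈ C) →
          ((Y.erase x).filter (· ∈ D)).card ≤ ((Y.erase x).filter (· ∈ C)).card := by
      intro i
      obtain ⟨z, hz⟩ := hne
      have := exists_minimalFor_of_wellFoundedLT
        (fun D : Finset α => D ∈ 𝒞 i ∧ x ∈ D ∧ ∃ z ∈ Y.erase x, z ∈ D)
        (fun D => ((Y.erase x).filter (· ∈ D)).card)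
        ⟨X, hX i, hY hx, z, hz, hY (Finset.mem_of_mem_erase hz)⟩
      obtain ⟨D, hD, hm⟩ := this
      refine ⟨D, hD, fun C h1 h2 h3 => ?_⟩
      by_contra hlt
      push Not at hlt
      have := hm (j := C) ⟨h1, h2, h3⟩ hlt.le
      dsimp only at this
      omega
    choose D hD hDm using hmin
    have hv : ∀ i, ∃ v, v ≠ G.root ∧ ∀ z ∈ Y.erase x, (G.R i v (ℓ z) ↔ z ∈ D i) :=
      fun i => hB.cl i (D i) (hD i).1 (hD i).2.2
    choose v hv hvD using hv
    obtain ⟨G', w, lf, hE⟩ := G.ext_del v {v | ∃ y ∈ Y.erase x, ℓ y = v} hv hB.okk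
    refine ⟨_, inferInstance, G', _, built_ext hx hB hE ?_⟩
    rintro i C hC ⟨z0, hz0, hz0C⟩
    obtain ⟨hDi, hxD, t, ht, htD⟩ := hD i
    by_cases hxC : x ∈ C
    · by_cases hex : ∃ z ∈ Y.erase x, z ∈ C
      · by_cases heq : ∀ z ∈ Y.erase x, (z ∈ C ↔ z ∈ D i)
        · exact Or.inr (Or.inr ⟨hxC, fun z hz => (hvD i z hz).trans (heq z hz).symm⟩)
        · obtain ⟨c, hc, hc2⟩ := hB.cl i C hC hex
          have hDC : D i ⊆ C := by
            rcases hlam i C hC (D i) hDi x hxC hxD with hs | hs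
            · exfalso
              apply heq
              have hsub : (Y.erase x).filter (· ∈ C) ⊆ (Y.erase x).filter (· ∈ D i) := by
                intro z hz
                rw [Finset.mem_filter] at hz ⊢
                exact ⟨hz.1, hs hz.2⟩
              have := Finset.eq_of_subset_of_card_le hsub (hDm i C hC hxC hex)
              intro z hz
              refine ⟨fun h => hs h, fun h => ?_⟩
              have hz2 : z ∈ (Y.erase x).filter (· ∈ D i) := Finset.mem_filter.2 ⟨hz, h⟩
              rw [← this, Finset.mem_filter] at hz2
              exact hz2.2
            · exact hs
          have hnle : ¬ G.R i (v i) c := by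
            intro hr
            apply heq
            intro z hz
            refine ⟨fun h => ?_, fun h => hDC h⟩
            exact (hvD i z hz).1 (hr.trans ((hc2 z hz).2 h))
          refine Or.inr (Or.inl ⟨c, hc, hc2, ⟨fun _ => ⟨?_, ?_⟩, fun _ => hxC⟩⟩)
          · rintro rfl; exact hnle .refl
          · rcases G.R_comp ((hc2 t ht).2 (hDC htD)) ((hvD i t ht).2 htD) with h | h
            · exact h
            · exact absurd h hnle
      · push Not at hex
        exact Or.inl ⟨hxC, hex⟩
    · by_cases heq : ∀ z ∈ Y.erase x, (z ∈ C ↔ z ∈ D i)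
      · refine Or.inr (Or.inl ⟨v i, hv i, fun z hz => (hvD i z hz).trans (heq z hz).symm, ?_⟩)
        simp [hxC]
      · obtain ⟨c, hc, hc2⟩ := hB.cl i C hC ⟨z0, Finset.mem_erase.2
          ⟨by rintro rfl; exact hxC hz0C, hz0⟩, hz0C⟩
        refine Or.inr (Or.inl ⟨c, hc, hc2, ⟨fun h => absurd h hxC, fun hr => ?_⟩⟩)
        exfalso
        have hsub : ∀ z ∈ Y.erase x, z ∈ D i → z ∈ C := fun z hz hzD =>
          (hc2 z hz).1 (hr.2.trans ((hvD i z hz).2 hzD))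
        rcases hlam i C hC (D i) hDi t (hsub t ht htD) htD with hs | hs
        · exact heq fun z hz => ⟨fun h => hs h, hsub z hz⟩
        · exact hxC (hs hxD)

end Bu
end Phylo

namespace Phylo

section Fin1
open Relation
variable {α : Type}

theorem rtg_equiv {A B : Type} (e : A ≃ B) (r : B → B → Prop) (a b : A) :
    ReflTransGen (fun a b => r (e a) (e b)) a b ↔ ReflTransGen r (e a) (e b) := by
  constructor
  · intro h
    induction h with
    | refl => exact .refl
    | tail _ h ih => exact .tail ih h
  · intro h
    have : ∀ u v, ReflTransGen r u v →
        ReflTransGen (fun a b => r (e a) (e b)) (e.symm u) (e.symm v) := by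
      intro u v h
      induction h with
      | refl => exact .refl
      | tail _ h ih => exact .tail ih (by simpa using h)
    simpa using this _ _ h

theorem net_of_built {X : Finset α} (hX : X.Nonempty) {𝒞 : Bool → Set (Finset α)} {k : ℕ}
    {V : Type} [Fintype V] {G : PG V} {ℓ : α → V} (hB : BuiltG 𝒞 X k G ℓ) :
    ∃ (N : Net α) (s : Bool → Fin N.n → Fin N.n → Prop) (r : Fin N.n),
      IsPhyloNet X N ∧ N.reticNum ≤ k ∧ (∀ i a b, s i a b → N.Adj a b) ∧
      (∀ i a b c, s i a c → s i b c → a = b) ∧ (∀ i v, ReflTransGen (s i) r v) ∧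
      (∀ a, ¬ N.Adj a r) ∧ ∀ i, ∀ C ∈ 𝒞 i, (∃ z ∈ X, z ∈ C) → ∃ v, v ≠ r ∧
        ∀ w, N.IsLeaf w → (ReflTransGen (s i) v w ↔ N.label w ∈ C) := by
  have : Nonempty α := ⟨hX.choose⟩
  let lab : V → α := Function.invFunOn ℓ (X : Set α)
  have hlab : ∀ x ∈ X, lab (ℓ x) = x := fun x hx =>
    Set.InjOn.leftInvOn_invFunOn (f := ℓ) (s := (X : Set α))
      (fun a ha b hb h => hB.inj a ha b hb h) hx
  have hac : ∀ a b, TransGen G.E a b → G.rank a < G.rank b := by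
    have h1 : ∀ a b, G.E a b → G.rank a < G.rank b := by
      rintro a b ⟨i, h, rfl⟩
      exact G.hrank i b h
    intro a b h
    induction h with
    | single h => exact h1 _ _ h
    | tail _ h ih => exact ih.trans (h1 _ _ h)
  have hleaf : ∀ v, (∀ b, ¬ G.E v b) → ∃ y ∈ X, ℓ y = v := by
    intro v hv
    rcases hB.okk v with h | ⟨-, ⟨b, hb⟩, -⟩
    · exact h.1
    · exact absurd hb (hv b)
  have hPN : IsPN X G.E lab G.root := by
    refine ⟨fun v h => lt_irrefl _ (hac _ _ h), ?_, ?_, ?_, ?_, ?_, ?_, ?_⟩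
    · rintro a ⟨i, h, -⟩; exact h rfl
    · intro b hb; exact ⟨_, false, hb, rfl⟩
    · rintro v hv ⟨b, hb⟩ hu
      rcases hB.okk v with h | ⟨-, -, h⟩
      · exact absurd hb (h.2.2.1 b)
      · exact h hv fun hr => hr.2 (hu _ _ ⟨false, hv, rfl⟩ ⟨true, hv, rfl⟩)
    · rintro v ⟨a, b, hab, ⟨i, hi, hi'⟩, ⟨j, hj, hj'⟩⟩
      rcases hB.okk v with h | ⟨-, h, -⟩
      · exfalso
        apply h.2.2.2
        refine ⟨hi, fun he => hab ?_⟩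
        rw [← hi', ← hj']
        cases i <;> cases j <;> simp [he]
      · exact h
    · intro v hv
      obtain ⟨y, hy, rfl⟩ := hleaf v hv
      rw [hlab y hy]; exact hy
    · intro v hv w hw h
      obtain ⟨y, hy, rfl⟩ := hleaf v hv
      obtain ⟨z, hz, rfl⟩ := hleaf w hw
      rw [hlab y hy, hlab z hz] at h
      rw [h]
    · intro x hx
      exact ⟨ℓ x, (hB.leaf hx).2.1, hlab x hx⟩
  refine ⟨mkNet V G.E lab, fun i a b => G.step i (toV G.E lab a) (toV G.E lab b),
    (toV G.E lab).symm G.root, hPN.phylo, ?_, ?_, ?_, ?_, ?_, ?_⟩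
  · refine (mkNet_retic_le (Set.toFinset {b | G.retic b}) ?_ ?_).trans ?_
    · intro v hv a b ha hb
      rw [Set.mem_toFinset] at hv
      obtain ⟨i, hi, hi'⟩ := ha
      obtain ⟨j, hj, hj'⟩ := hb
      have he : G.par false v = G.par true v := by
        by_contra h
        exact hv ⟨hi, h⟩
      rw [← hi', ← hj']
      cases i <;> cases j <;> simp [he]
    · intro v
      refine ⟨G.par false v, G.par true v, ?_⟩
      rintro c ⟨i, -, rfl⟩
      cases i
      · exact Or.inl rfl
      · exact Or.inr rfl
    · rw [← Set.ncard_eq_toFinset_card']; exact hB.card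
  · intro i a b h
    exact (mkNet_adj _ _ _ _).2 ⟨i, h⟩
  · intro i a b c h1 h2
    exact (toV G.E lab).injective (h1.2.symm.trans h2.2)
  · intro i v
    rw [rtg_equiv (toV G.E lab) (G.step i), Equiv.apply_symm_apply]
    exact G.root_R i _
  · intro a h
    have := (mkNet_adj _ _ _ _).1 h
    rw [Equiv.apply_symm_apply] at this
    exact hPN.noPar _ this
  · intro i C hC hne
    obtain ⟨v, hv, hv2⟩ := hB.cl i C hC hne
    refine ⟨(toV G.E lab).symm v, fun h => hv ((toV G.E lab).symm.injective h), fun w hw => ?_⟩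
    rw [rtg_equiv (toV G.E lab) (G.step i), Equiv.apply_symm_apply, mkNet_label]
    obtain ⟨y, hy, he⟩ := hleaf _ ((mkNet_leaf _ _ _).1 hw)
    rw [← he, hlab y hy]
    exact hv2 y hy

variable [DecidableEq α]

theorem mem_clb {X : Finset α} {T : Net α} {ℓ : α → Fin T.n} (hℓ : LeafMap X T ℓ)
    {x : α} (hx : x ∈ X) (v : Fin T.n) : x ∈ T.clusterBelow v ↔ T.Reaches v (ℓ x) := by
  simp only [Net.clusterBelow, Finset.mem_image, Finset.mem_filter, Finset.mem_univ, true_and]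
  constructor
  · rintro ⟨w, ⟨h1, h2⟩, h3⟩
    rw [← (hℓ x hx).2.2 w h2 h3]; exact h1
  · intro h
    exact ⟨ℓ x, ⟨h, (hℓ x hx).1⟩, (hℓ x hx).2.1⟩

theorem clb_sub {X : Finset α} {T : Net α} (hT : IsPhyloNet X T) (v : Fin T.n) :
    T.clusterBelow v ⊆ X := by
  intro x hx
  simp only [Net.clusterBelow, Finset.mem_image, Finset.mem_filter, Finset.mem_univ, true_and] at hx
  obtain ⟨w, ⟨-, h2⟩, rfl⟩ := hx
  exact hT.2.2.2.2.1 h2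

theorem clb_nonempty {X : Finset α} {T : Net α} (hT : IsPhyloNet X T) (v : Fin T.n) :
    (T.clusterBelow v).Nonempty := by
  obtain ⟨w, h1, h2⟩ := exists_lowest hT.1 (fun w => T.Reaches v w) ⟨v, .refl⟩
  refine ⟨T.label w, ?_⟩
  simp only [Net.clusterBelow, Finset.mem_image, Finset.mem_filter, Finset.mem_univ, true_and]
  exact ⟨w, ⟨h1, (isLeaf_iff T w).2 fun b hb => h2 b (.single hb) (h1.tail hb)⟩, rfl⟩

theorem clSet_lam {X : Finset α} {T : Net α} (hT : IsPhyloTree X T) {A B : Finset α}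
    (hA : A ∈ clSet T) (hB : B ∈ clSet T) {z : α} (hzA : z ∈ A) (hzB : z ∈ B) : A ⊆ B ∨ B ⊆ A := by
  obtain ⟨ℓ, hℓ⟩ := hT.1.leaf
  obtain ⟨e, -, rfl⟩ := hA
  obtain ⟨f, -, rfl⟩ := hB
  have hu : ∀ a b c, T.Adj a c → T.Adj b c → a = b :=
    fun a b c => (reticNum_eq_zero T).1 hT.2 c a b
  have hz := clb_sub hT.1 _ hzA
  have mono : ∀ u v, T.Reaches u v → T.clusterBelow v ⊆ T.clusterBelow u := by
    intro u v h x hx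
    have hxX := clb_sub hT.1 _ hx
    rw [mem_clb hℓ hxX] at hx ⊢
    exact h.trans hx
  rcases rtg_comparable hu ((mem_clb hℓ hz _).1 hzA) ((mem_clb hℓ hz _).1 hzB) with h | h
  · exact Or.inr (mono _ _ h)
  · exact Or.inl (mono _ _ h)

theorem trip_of_cl {X : Finset α} {T : Net α} (hT : IsPhyloTree X T) {C : Finset α}
    (hC : C ∈ clSet T) {x y z : α} (hxy : x ≠ y) (hx : x ∈ C) (hy : y ∈ C) (hz : z ∈ X)
    (hzC : z ∉ C) : ConsistentTriplet T x y z := by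
  obtain ⟨ℓ, hℓ⟩ := hT.1.leaf
  obtain ⟨e, -, rfl⟩ := hC
  have hu : ∀ a b c, T.Adj a c → T.Adj b c → a = b :=
    fun a b c => (reticNum_eq_zero T).1 hT.2 c a b
  obtain ⟨ρ, -, -, hρ⟩ := hT.1.root
  have hxX := clb_sub hT.1 _ hx
  have hyX := clb_sub hT.1 _ hy
  refine triplet_of_switch hT.1.1 (fun _ _ h => h) hu ρ hρ hxy ?_ ?_
    ⟨(hℓ x hxX).1, (hℓ x hxX).2.1⟩ ⟨(hℓ y hyX).1, (hℓ y hyX).2.1⟩ ⟨(hℓ z hz).1, (hℓ z hz).2.1⟩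
    ((mem_clb hℓ hxX _).1 hx) ((mem_clb hℓ hyX _).1 hy) (fun h => hzC ((mem_clb hℓ hz _).2 h))
  · rintro rfl; exact hzC hy
  · rintro rfl; exact hzC hx

theorem trip_sep {X : Finset α} {N : Net α} (hN : IsPhyloNet X N) {ℓ : α → Fin N.n}
    (hℓ : LeafMap X N ℓ) {x y z : α} (hxz : x ≠ z) (hyz : y ≠ z)
    (h : ConsistentTriplet N x y z) :
    (x ∈ X ∧ y ∈ X ∧ z ∈ X) ∧ Sep N.Adj ℓ x y z := by
  obtain ⟨t, ht, -, ⟨e, -, he⟩, hD⟩ := h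
  have hsub : ({x, y, z} : Finset α) ⊆ X := by
    intro a ha
    obtain ⟨w, hw, rfl⟩ := ht.1.2.2.2.2.2.2 ha
    obtain ⟨φ, -, h2, -⟩ := hD
    rw [← (h2 w hw).2]
    exact hN.2.2.2.2.1 (h2 w hw).1
  refine ⟨⟨hsub (by simp), hsub (by simp), hsub (by simp)⟩, ?_⟩
  exact sep_of_display hsub hN hℓ ht hD e.2 x y z (by simp [he]) (by simp [he]) (by simp)
    (by simp [he, hxz.symm, hyz.symm])

theorem cl_of_trip {X : Finset α} {T : Net α} (hT : IsPhyloTree X T) {x y z : α} (hxz : x ≠ z)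
    (hyz : y ≠ z) (h : ConsistentTriplet T x y z) :
    ∃ C ∈ clSet T, x ∈ C ∧ y ∈ C ∧ z ∈ X ∧ z ∉ C := by
  obtain ⟨ℓ, hℓ⟩ := hT.1.leaf
  obtain ⟨⟨hx, hy, hz⟩, σ, hσ, p, h1, h2, h3⟩ := trip_sep hT.1 hℓ hxz hyz h
  have hu : ∀ c a b, T.Adj a c → T.Adj b c → a = b := (reticNum_eq_zero T).1 hT.2
  have hsr : ∀ a b, T.Reaches a b → SR T.Adj σ a b := by
    intro a b h
    induction h with
    | refl => exact .refl
    | tail _ h ih => exact ih.tail ⟨h, hu _ _ _ (hσ _ ⟨_, h⟩) h⟩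
  obtain ⟨ρ, -, hρ2, hρ⟩ := hT.1.root
  have hp : p ≠ ρ := by
    rintro rfl
    exact h3 (hsr _ _ (hρ _))
  obtain ⟨a, ha⟩ := hρ2 p hp
  refine ⟨T.clusterBelow p, ⟨(a, p), ha, rfl⟩, (mem_clb hℓ hx _).2 h1.reach,
    (mem_clb hℓ hy _).2 h2.reach, hz, fun h => h3 (hsr _ _ ((mem_clb hℓ hz _).1 h))⟩

/-- All the clusters of the two trees, together with the full set. -/
def CC (X : Finset α) (T₁ T₂ : Net α) (i : Bool) : Set (Finset α) :=
  insert X (clSet (if i then T₂ else T₁))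

theorem red_of_hsep {X : Finset α} {N T₁ T₂ : Net α} (hN : IsPhyloNet X N) {ℓ : α → Fin N.n}
    (h : ∀ C ∈ clSet T₁ ∪ clSet T₂, ∀ x ∈ X, ∀ z ∈ X, ∀ y ∈ X, x ≠ z → x ∈ C → z ∈ C → y ∉ C →
      Sep N.Adj ℓ x z y) : Red (CC X T₁ T₂ false ∪ CC X T₁ T₂ true) X N.reticNum := by
  refine red_of_sep hN ℓ _ ?_
  intro C hC x hx z hz y hy hxz hxC hzC hyC
  have : C ∈ clSet T₁ ∪ clSet T₂ := by
    rcases hC with (rfl | hC) | (rfl | hC)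
    · exact absurd hy hyC
    · exact Or.inl (by simpa using hC)
    · exact absurd hy hyC
    · exact Or.inr (by simpa using hC)
  exact h C this x hx z hz y hy hxz hxC hzC hyC

theorem red_of_rep {X : Finset α} {N T₁ T₂ : Net α} (hN : IsPhyloNet X N)
    (h : RepresentsSet X N (clSet T₁ ∪ clSet T₂)) :
    Red (CC X T₁ T₂ false ∪ CC X T₁ T₂ true) X N.reticNum := by
  obtain ⟨ℓ, hℓ⟩ := hN.leaf
  refine red_of_hsep hN (ℓ := ℓ) ?_
  intro C hC x hx z hz y hy hxz hxC hzC hyC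
  obtain ⟨T, hT, hD, e, -, rfl⟩ := h C hC
  exact sep_of_display subset_rfl hN hℓ hT hD e.2 x z y hxC hzC hy hyC

theorem upper {X : Finset α} {T₁ T₂ : Net α} (h₁ : IsPhyloTree X T₁) (h₂ : IsPhyloTree X T₂)
    {k : ℕ} (hR : Red (CC X T₁ T₂ false ∪ CC X T₁ T₂ true) X k) :
    ∃ N : Net α, IsPhyloNet X N ∧ N.reticNum ≤ k ∧
      (∀ i : Bool, ∃ T', IsRefinement X (if i then T₂ else T₁) T' ∧ Displays N T') ∧
      (∀ i : Bool, ∀ x y z : α, x ≠ y → y ≠ z → x ≠ z →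
        ConsistentTriplet (if i then T₂ else T₁) x y z → ConsistentTriplet N x y z) := by
  have hT : ∀ i : Bool, IsPhyloTree X (if i then T₂ else T₁) := by
    rintro (_ | _)
    · exact h₁
    · exact h₂
  have hsub : ∀ i : Bool, ∀ C ∈ clSet (if i then T₂ else T₁), C ⊆ X ∧ C.Nonempty := by
    rintro i _ ⟨e, -, rfl⟩
    exact ⟨clb_sub (hT i).1 _, clb_nonempty (hT i).1 _⟩
  have hlam : ∀ i, ∀ A ∈ CC X T₁ T₂ i, ∀ B ∈ CC X T₁ T₂ i, ∀ z, z ∈ A → z ∈ B → A ⊆ B ∨ B ⊆ A := by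
    rintro i A (rfl | hA) B (rfl | hB) z hzA hzB
    · exact Or.inl subset_rfl
    · exact Or.inr (hsub i _ hB).1
    · exact Or.inl (hsub i _ hA).1
    · exact clSet_lam (hT i) hA hB hzA hzB
  obtain ⟨V, _, G, ℓ, hB⟩ := built_of_red X (CC X T₁ T₂) (fun i => Or.inl rfl) hlam hR subset_rfl
  obtain ⟨N, s, r, hN, hk, hs, hu, hr, hrp, hcl⟩ := net_of_built h₁.1.nonempty hB
  refine ⟨N, hN, hk, fun i => ?_, fun i x y z hxy hyz hxz ht => ?_⟩
  · obtain ⟨T', hT', hD, hC⟩ := tree_of_switch hN (hs i) (hu i) r (hr i) hrp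
    refine ⟨T', ⟨hT', fun C hCi => ?_⟩, hD⟩
    obtain ⟨h1, c, hc⟩ := hsub i C hCi
    obtain ⟨v, hv, hv2⟩ := hcl i C (Or.inr hCi) ⟨c, h1 hc, hc⟩
    exact hC v hv C ⟨c, hc⟩ h1 hv2
  · obtain ⟨C, hC, hx, hy, hz, hzC⟩ := cl_of_trip (hT i) hxz hyz ht
    obtain ⟨h1, -⟩ := hsub i C hC
    obtain ⟨v, hv, hv2⟩ := hcl i C (Or.inr hC) ⟨x, h1 hx, hx⟩
    obtain ⟨m, hm⟩ := hN.leaf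
    obtain ⟨x1, x2, -⟩ := hm x (h1 hx)
    obtain ⟨y1, y2, -⟩ := hm y (h1 hy)
    obtain ⟨z1, z2, -⟩ := hm z hz
    exact triplet_of_switch hN.1 (hs i) (hu i) r (hr i) hxy hyz hxz ⟨x1, x2⟩ ⟨y1, y2⟩ ⟨z1, z2⟩
      ((hv2 _ x1).2 (x2.symm ▸ hx)) ((hv2 _ y1).2 (y2.symm ▸ hy))
      (fun h => hzC (z2 ▸ (hv2 _ z1).1 h))

theorem sInf_eq_of {A B : Set ℕ} {P : ℕ → Prop} (hA : ∀ k ∈ A, P k) (hB : ∀ k ∈ B, P k)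
    (hP : ∀ k, P k → ∃ m ≤ k, m ∈ A ∧ m ∈ B) (hne : ∃ k, P k) : sInf A = sInf B := by
  obtain ⟨k, hk⟩ := hne
  obtain ⟨m, -, hmA, hmB⟩ := hP k hk
  apply le_antisymm
  · obtain ⟨n, hn, hnA, -⟩ := hP _ (hB _ (Nat.sInf_mem ⟨m, hmB⟩))
    exact (Nat.sInf_le hnA).trans hn
  · obtain ⟨n, hn, -, hnB⟩ := hP _ (hA _ (Nat.sInf_mem ⟨m, hmA⟩))
    exact (Nat.sInf_le hnB).trans hn

end Fin1

/-- For two (not necessarily binary) rooted phylogenetic trees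
`T₁, T₂` on `X`: `r_tr(𝒯) = h⁰(𝒯) = r(Cl(𝒯))`. -/
theorem rtr_eq_h0_eq_rNum_two_trees {α : Type} [DecidableEq α] (X : Finset α)
    (T₁ T₂ : Net α) (h₁ : IsPhyloTree X T₁) (h₂ : IsPhyloTree X T₂) :
    rtr X ![T₁, T₂] = h0 X ![T₁, T₂] ∧
      h0 X ![T₁, T₂] = rNum X (clSet T₁ ∪ clSet T₂) := by
  have hne : ∃ k, Red (CC X T₁ T₂ false ∪ CC X T₁ T₂ true) X k := Red.exists X h₁.1.nonempty
  have hrep : ∀ N : Net α, (∀ i, ∃ T', IsRefinement X (![T₁, T₂] i) T' ∧ Displays N T') →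
      RepresentsSet X N (clSet T₁ ∪ clSet T₂) := by
    intro N h C hC
    rw [Fin.forall_fin_two] at h
    obtain ⟨⟨S, ⟨hS, hS2⟩, hS3⟩, ⟨S', ⟨hS', hS2'⟩, hS3'⟩⟩ := h
    rcases hC with hC | hC
    · exact ⟨S, hS, hS3, hS2 hC⟩
    · exact ⟨S', hS', hS3', hS2' hC⟩
  have hup : ∀ k, Red (CC X T₁ T₂ false ∪ CC X T₁ T₂ true) X k → ∃ N : Net α, IsPhyloNet X N ∧
      N.reticNum ≤ k ∧ (∀ i, ∃ T', IsRefinement X (![T₁, T₂] i) T' ∧ Displays N T') ∧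
      (∀ x y z : α, x ≠ y → y ≠ z → x ≠ z →
        (∃ i, ConsistentTriplet (![T₁, T₂] i) x y z) → ConsistentTriplet N x y z) := by
    intro k hk
    obtain ⟨N, hN, h1, h2, h3⟩ := upper h₁ h₂ hk
    refine ⟨N, hN, h1, ?_, ?_⟩
    · rw [Fin.forall_fin_two]
      exact ⟨h2 false, h2 true⟩
    · intro x y z hxy hyz hxz h
      rw [Fin.exists_fin_two] at h
      rcases h with h | h
      · exact h3 false x y z hxy hyz hxz h
      · exact h3 true x y z hxy hyz hxz h
  have hh : ∀ k ∈ {k | ∃ N : Net α, IsPhyloNet X N ∧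
      (∀ i, ∃ T', IsRefinement X (![T₁, T₂] i) T' ∧ Displays N T') ∧ N.reticNum = k},
      Red (CC X T₁ T₂ false ∪ CC X T₁ T₂ true) X k := by
    rintro k ⟨N, hN, h, rfl⟩
    exact red_of_rep hN (hrep N h)
  constructor
  · refine sInf_eq_of ?_ hh ?_ hne
    · rintro k ⟨N, hN, h, rfl⟩
      obtain ⟨ℓ, hℓ⟩ := hN.leaf
      refine red_of_hsep hN (ℓ := ℓ) ?_
      intro C hC x hx z hz y hy hxz hxC hzC hyC
      have hxy : x ≠ y := by rintro rfl; exact hyC hxC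
      have hzy : z ≠ y := by rintro rfl; exact hyC hzC
      refine (trip_sep hN hℓ hxy hzy (h x z y hxz hzy hxy ?_)).2
      rw [Fin.exists_fin_two]
      rcases hC with hC | hC
      · exact Or.inl (trip_of_cl h₁ hC hxz hxC hzC hy hyC)
      · exact Or.inr (trip_of_cl h₂ hC hxz hxC hzC hy hyC)
    · intro k hk
      obtain ⟨N, hN, h1, h2, h3⟩ := hup k hk
      exact ⟨_, h1, ⟨N, hN, h3, rfl⟩, ⟨N, hN, h2, rfl⟩⟩
  · refine sInf_eq_of hh ?_ ?_ hne
    · rintro k ⟨N, hN, h, rfl⟩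
      exact red_of_rep hN h
    · intro k hk
      obtain ⟨N, hN, h1, h2, h3⟩ := hup k hk
      exact ⟨_, h1, ⟨N, hN, h2, rfl⟩, ⟨N, hN, hrep N h2, rfl⟩⟩

end Phylo
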